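/- Let M > 0, R > 1, and let ω ∈ C^∞(ℝ) satisfy |ω(ξ)| ≤ 1 for all ξ, ω(ξ) = 0 for |ξ| ≤ 1, and ω constant on each of {ξ ≥ R} and {ξ ≤ −R}. For h ≥ 1 define λ(x,ξ) := M·ω(ξ/h)·∫₀ˣ ⟨y⟩^{-1} dy. Then there exists h₁ ≥ 1 (depending on M, R, ω) such that for every h ≥ h₁ the operator e^{λ}(x,D) : 𝒮(ℝ) → 𝒮(ℝ), defined by e^{λ}(x,D)u(x) = (2π)^{−1} ∫ e^{ixξ} e^{λ(x,ξ)} û(ξ) dξ, is a linear bijection of 𝒮(ℝ) onto itself. -/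

import Mathlib

open MeasureTheory Real

noncomputable section

/-- The Japanese bracket `⟨x⟩ = (1 + x²)^(1/2)`. -/
def jb (x : ℝ) : ℝ := Real.sqrt (1 + x ^ 2)

/-- The pseudo-differential operator
`a(x,D)u(x) = (2π)⁻¹ ∫ e^{ixξ} a(x,ξ) û(ξ) dξ`, with `û(ξ) = ∫ e^{-iyξ} u(y) dy`. -/
def psdo1 (a : ℝ → ℝ → ℂ) (u : ℝ → ℂ) (x : ℝ) : ℂ :=
  (((2 * Real.pi)⁻¹ : ℝ) : ℂ) *
    ∫ ξ : ℝ, Complex.exp (Complex.I * (x:ℂ) * (ξ:ℂ)) * a x ξ *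
      ∫ y : ℝ, Complex.exp (-Complex.I * (y:ℂ) * (ξ:ℂ)) * u y

/-- A function on the line decaying faster than every power. -/
def RapidDecay (f : ℝ → ℂ) : Prop := ∀ n : ℕ, ∃ C : ℝ, ∀ x, (1 + |x|) ^ n * ‖f x‖ ≤ C

namespace RapidDecay

theorem add {f g : ℝ → ℂ} (hf : RapidDecay f) (hg : RapidDecay g) :
    RapidDecay (fun x => f x + g x) := by
  intro n
  obtain ⟨C, hC⟩ := hf n
  obtain ⟨C', hC'⟩ := hg n
  refine ⟨C + C', fun x => ?_⟩
  calc (1 + |x|) ^ n * ‖f x + g x‖ ≤ (1 + |x|) ^ n * (‖f x‖ + ‖g x‖) := by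
        gcongr; exact norm_add_le _ _
    _ ≤ C + C' := by rw [mul_add]; exact add_le_add (hC x) (hC' x)

theorem mul_of_le_pow {f b : ℝ → ℂ} (hf : RapidDecay f) {C : ℝ} {k : ℕ}
    (hb : ∀ x, ‖b x‖ ≤ C * (1 + |x|) ^ k) : RapidDecay (fun x => b x * f x) := by
  intro n
  obtain ⟨C', hC'⟩ := hf (n + k)
  refine ⟨C * C', fun x => ?_⟩
  have hC0 : 0 ≤ C := by simpa using (norm_nonneg _).trans (hb 0)
  calc (1 + |x|) ^ n * ‖b x * f x‖ = ‖b x‖ * ((1 + |x|) ^ n * ‖f x‖) := by rw [norm_mul]; ring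
    _ ≤ C * (1 + |x|) ^ k * ((1 + |x|) ^ n * ‖f x‖) := by gcongr; exact hb x
    _ = C * ((1 + |x|) ^ (n + k) * ‖f x‖) := by rw [pow_add]; ring
    _ ≤ C * C' := by gcongr; exact hC' x

theorem mul_temperate {f b : ℝ → ℂ} (hf : RapidDecay f) (hb : b.HasTemperateGrowth) :
    RapidDecay (fun x => b x * f x) := by
  obtain ⟨k, C, hC⟩ := hb.2 0
  exact hf.mul_of_le_pow (C := C) (k := k) (by simpa using hC)

theorem integrable {f : ℝ → ℂ} (hf : RapidDecay f) (hm : AEStronglyMeasurable f) :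
    Integrable f := by
  obtain ⟨C, hC⟩ := hf 2
  have h : Integrable (fun x : ℝ => C * (1 + ‖x‖) ^ (-2 : ℝ)) :=
    (integrable_one_add_norm (by simp)).const_mul C
  refine h.mono' hm (Filter.Eventually.of_forall fun x => ?_)
  have hx : 0 < 1 + |x| := by positivity
  rw [Real.norm_eq_abs, Real.rpow_neg hx.le, Real.rpow_ofNat, ← div_eq_mul_inv,
    le_div_iff₀ (by positivity), mul_comm]
  exact hC x

theorem integrable_pow_mul_norm {f : ℝ → ℂ} (hf : RapidDecay f) (hm : AEStronglyMeasurable f)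
    (n : ℕ) : Integrable (fun x => (1 + |x|) ^ n * ‖f x‖) := by
  have h : RapidDecay (fun x => (((1 + |x|) ^ n : ℝ) : ℂ) * f x) :=
    hf.mul_of_le_pow (b := fun x => (((1 + |x|) ^ n : ℝ) : ℂ)) (C := 1) (k := n) fun x => by
      rw [Complex.norm_real, Real.norm_of_nonneg (by positivity), one_mul]
  have hc : Continuous fun x : ℝ => (((1 + |x|) ^ n : ℝ) : ℂ) := by fun_prop
  refine (h.integrable (hc.aestronglyMeasurable.mul hm)).norm.congr
    (Filter.Eventually.of_forall fun x => ?_)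
  simp only
  rw [norm_mul, Complex.norm_real, Real.norm_of_nonneg (by positivity)]

theorem of_pow_mul_le {f : ℝ → ℂ} (h : ∀ n : ℕ, ∃ C : ℝ, ∀ x, |x| ^ n * ‖f x‖ ≤ C) :
    RapidDecay f := by
  intro n
  obtain ⟨C₀, h₀⟩ := h 0
  obtain ⟨C₁, h₁⟩ := h n
  refine ⟨2 ^ (n - 1) * (C₀ + C₁), fun x => ?_⟩
  calc (1 + |x|) ^ n * ‖f x‖ ≤ 2 ^ (n - 1) * (1 ^ n + |x| ^ n) * ‖f x‖ := by
        gcongr; exact add_pow_le zero_le_one (abs_nonneg x) n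
    _ = 2 ^ (n - 1) * (|x| ^ 0 * ‖f x‖ + |x| ^ n * ‖f x‖) := by simp; ring
    _ ≤ _ := by gcongr; exacts [h₀ x, h₁ x]

end RapidDecay

theorem SchwartzMap.rapidDecay (q : SchwartzMap ℝ ℂ) : RapidDecay q := by
  refine .of_pow_mul_le fun n => ?_
  obtain ⟨C, -, hC⟩ := q.decay n 0
  exact ⟨C, fun x => by simpa using hC x⟩

/-- Functions generated from a family by sums and multiplication by functions of temperate
growth. -/
inductive TemperateSpan {ι : Type*} (G : ι → ℝ → ℂ) : (ℝ → ℂ) → Prop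
  | base (i : ι) : TemperateSpan G (G i)
  | add {f g : ℝ → ℂ} (hf : TemperateSpan G f) (hg : TemperateSpan G g) :
      TemperateSpan G (fun x => f x + g x)
  | mul {b f : ℝ → ℂ} (hb : b.HasTemperateGrowth) (hf : TemperateSpan G f) :
      TemperateSpan G (fun x => b x * f x)

namespace TemperateSpan

variable {ι : Type*} {G : ι → ℝ → ℂ} {f : ℝ → ℂ}

theorem rapidDecay (hG : ∀ i, RapidDecay (G i)) (hf : TemperateSpan G f) : RapidDecay f := by
  induction hf with
  | base i => exact hG i
  | add _ _ hf hg => exact hf.add hg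
  | mul hb _ hf => exact hf.mul_temperate hb

end TemperateSpan

theorem Function.HasTemperateGrowth.deriv {b : ℝ → ℂ} (hb : b.HasTemperateGrowth) :
    (deriv b).HasTemperateGrowth := by
  have h1 : ContDiff ℝ (⊤ : ℕ∞) (_root_.deriv b) := (contDiff_infty_iff_deriv.1 hb.1).2
  refine ⟨h1, fun n => ?_⟩
  obtain ⟨k, C, hC⟩ := hb.2 (n + 1)
  refine ⟨k, C, fun x => ?_⟩
  rw [norm_iteratedFDeriv_eq_norm_iteratedDeriv, ← iteratedDeriv_succ',
    ← norm_iteratedFDeriv_eq_norm_iteratedDeriv]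
  exact hC x

namespace TemperateSpan

variable {ι : Type*} {G : ι → ℝ → ℂ} {f : ℝ → ℂ}

theorem exists_hasDerivAt
    (hG : ∀ i, ∃ f', TemperateSpan G f' ∧ ∀ x, HasDerivAt (G i) (f' x) x)
    (hf : TemperateSpan G f) : ∃ f', TemperateSpan G f' ∧ ∀ x, HasDerivAt f (f' x) x := by
  induction hf with
  | base i => exact hG i
  | add _ _ hf hg =>
    obtain ⟨f', h1, h2⟩ := hf
    obtain ⟨g', h3, h4⟩ := hg
    exact ⟨_, h1.add h3, fun x => (h2 x).add (h4 x)⟩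
  | @mul b f hb hs hf =>
    obtain ⟨f', h1, h2⟩ := hf
    refine ⟨_, (hs.mul hb.deriv).add (h1.mul hb), fun x => ?_⟩
    exact ((hb.1.differentiable (by simp)) x).hasDerivAt.mul (h2 x)

/-- A family of rapidly decaying functions whose derivatives lie in its temperate span consists
of Schwartz functions. -/
theorem exists_schwartzMap (hG : ∀ i, RapidDecay (G i))
    (hG' : ∀ i, ∃ f', TemperateSpan G f' ∧ ∀ x, HasDerivAt (G i) (f' x) x)
    (hf : TemperateSpan G f) : ∃ q : SchwartzMap ℝ ℂ, ∀ x, q x = f x := by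
  have key : ∀ n : ℕ, ∀ f, TemperateSpan G f →
      TemperateSpan G (iteratedDeriv n f) ∧ ContDiff ℝ n f := by
    intro n
    induction n with
    | zero =>
      intro f hf
      obtain ⟨f', -, h⟩ := exists_hasDerivAt hG' hf
      simp only [iteratedDeriv_zero, Nat.cast_zero, contDiff_zero]
      exact ⟨hf, continuous_iff_continuousAt.2 fun x => (h x).continuousAt⟩
    | succ n ih =>
      intro f hf
      obtain ⟨f', hf', h⟩ := exists_hasDerivAt hG' hf
      have hd : deriv f = f' := funext fun x => (h x).deriv
      rw [iteratedDeriv_succ', hd]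
      refine ⟨(ih f' hf').1, ?_⟩
      push_cast
      rw [contDiff_succ_iff_deriv]
      exact ⟨fun x => (h x).differentiableAt, by simp, hd ▸ (ih f' hf').2⟩
  refine ⟨⟨f, contDiff_infty.2 fun n => (key n f hf).2, fun k n => ?_⟩, fun x => rfl⟩
  obtain ⟨C, hC⟩ := rapidDecay hG (key n f hf).1 k
  refine ⟨C, fun x => le_trans ?_ (hC x)⟩
  rw [norm_iteratedFDeriv_eq_norm_iteratedDeriv, Real.norm_eq_abs]
  gcongr
  linarith

end TemperateSpan

/-- The oscillatory integral `∫ e^{iζξ} e^{dβ(ξ)} q(ξ) dξ`. -/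
def osc (β : ℝ → ℝ) (q : ℝ → ℂ) (ζ d : ℝ) : ℂ :=
  ∫ ξ : ℝ, Complex.exp (Complex.I * (ζ : ℂ) * (ξ : ℂ)) * ((Real.exp (d * β ξ) : ℝ) : ℂ) * q ξ

/-- Conditions on the exponent `β` making `osc β q ζ d` well behaved for `d ∈ D`. -/
structure OscAdmissible (β : ℝ → ℝ) (D : Set ℝ) (K : ℝ → ℝ) (m : ℕ) : Prop where
  temperate : (fun x => (β x : ℂ)).HasTemperateGrowth
  continuous_bound : Continuous K
  exp_le : ∀ d ∈ D, ∀ ξ, Real.exp (d * β ξ) ≤ K d * (1 + |ξ|) ^ m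

/-- Multiplication of a Schwartz function by a function of temperate growth. -/
abbrev tmul (b : ℝ → ℂ) (q : SchwartzMap ℝ ℂ) : SchwartzMap ℝ ℂ := SchwartzMap.smulLeftCLM ℂ b q

theorem tmul_apply {b : ℝ → ℂ} (hb : b.HasTemperateGrowth) (q : SchwartzMap ℝ ℂ) (x : ℝ) :
    tmul b q x = b x * q x := by
  simp [tmul, SchwartzMap.smulLeftCLM_apply_apply hb]

theorem norm_cexp_I_mul (x y : ℝ) : ‖Complex.exp (Complex.I * (x : ℂ) * (y : ℂ))‖ = 1 := by
  rw [show Complex.I * (x : ℂ) * (y : ℂ) = ((x * y : ℝ) : ℂ) * Complex.I by push_cast; ring,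
    Complex.norm_exp_ofReal_mul_I]

theorem hasTemperateGrowth_I_mul (c : ℂ) : (fun x : ℝ => c * (x : ℂ)).HasTemperateGrowth := by
  have : (fun x : ℝ => (x : ℂ)).HasTemperateGrowth :=
    Function.Complex.hasTemperateGrowth_ofReal
  exact (Function.HasTemperateGrowth.const c).mul this

namespace OscAdmissible

variable {β : ℝ → ℝ} {D : Set ℝ} {K : ℝ → ℝ} {m : ℕ}

theorem continuous (H : OscAdmissible β D K m) : Continuous β := by
  have h := Complex.continuous_re.comp H.temperate.1.continuous
  exact h

theorem nonneg (H : OscAdmissible β D K m) {d : ℝ} (hd : d ∈ D) : 0 ≤ K d := by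
  have h := H.exp_le d hd 0
  simp only [abs_zero, add_zero, one_pow, mul_one] at h
  exact (Real.exp_pos _).le.trans h

theorem norm_integrand_le (H : OscAdmissible β D K m) (q : ℝ → ℂ) (ζ : ℝ) {d : ℝ}
    (hd : d ∈ D) (ξ : ℝ) :
    ‖Complex.exp (Complex.I * (ζ : ℂ) * (ξ : ℂ)) * ((Real.exp (d * β ξ) : ℝ) : ℂ) * q ξ‖ ≤
      K d * ((1 + |ξ|) ^ m * ‖q ξ‖) := by
  rw [norm_mul, norm_mul, norm_cexp_I_mul, one_mul, Complex.norm_real,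
    Real.norm_of_nonneg (Real.exp_pos _).le, ← mul_assoc]
  gcongr
  exact H.exp_le d hd ξ

theorem continuous_integrand (H : OscAdmissible β D K m) {q : ℝ → ℂ} (hq : Continuous q)
    (ζ d : ℝ) : Continuous fun ξ : ℝ =>
      Complex.exp (Complex.I * (ζ : ℂ) * (ξ : ℂ)) * ((Real.exp (d * β ξ) : ℝ) : ℂ) * q ξ := by
  have := H.continuous
  fun_prop

theorem integrable (H : OscAdmissible β D K m) (q : SchwartzMap ℝ ℂ) (ζ : ℝ) {d : ℝ}
    (hd : d ∈ D) : Integrable fun ξ : ℝ =>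
      Complex.exp (Complex.I * (ζ : ℂ) * (ξ : ℂ)) * ((Real.exp (d * β ξ) : ℝ) : ℂ) * q ξ :=
  ((q.rapidDecay.integrable_pow_mul_norm q.continuous.aestronglyMeasurable m).const_mul (K d)).mono'
    (H.continuous_integrand q.continuous ζ d).aestronglyMeasurable
    (Filter.Eventually.of_forall (H.norm_integrand_le q ζ hd))

theorem norm_osc_le (H : OscAdmissible β D K m) (q : SchwartzMap ℝ ℂ) (ζ : ℝ) {d : ℝ}
    (hd : d ∈ D) : ‖osc β q ζ d‖ ≤ K d * ∫ ξ, (1 + |ξ|) ^ m * ‖q ξ‖ := by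
  rw [← integral_const_mul]
  exact norm_integral_le_of_norm_le
    ((q.rapidDecay.integrable_pow_mul_norm q.continuous.aestronglyMeasurable m).const_mul (K d))
    (Filter.Eventually.of_forall (H.norm_integrand_le q ζ hd))

theorem osc_by_parts (H : OscAdmissible β D K m) (q : SchwartzMap ℝ ℂ) (ζ : ℝ) {d : ℝ}
    (hd : d ∈ D) : Complex.I * ζ * osc β q ζ d =
      -osc β (SchwartzMap.derivCLM ℂ ℂ q) ζ d -
        d * osc β (tmul (deriv fun x => (β x : ℂ)) q) ζ d := by
  have hb : Differentiable ℝ fun x => (β x : ℂ) := H.temperate.1.differentiable (by simp)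
  have hder : ∀ ξ : ℝ, HasDerivAt
      (fun ξ : ℝ => Complex.exp (Complex.I * (ζ : ℂ) * (ξ : ℂ)) *
        ((Real.exp (d * β ξ) : ℝ) : ℂ) * q ξ)
      (Complex.I * ζ * (Complex.exp (Complex.I * (ζ : ℂ) * (ξ : ℂ)) *
        ((Real.exp (d * β ξ) : ℝ) : ℂ) * q ξ) +
        (Complex.exp (Complex.I * (ζ : ℂ) * (ξ : ℂ)) *
        ((Real.exp (d * β ξ) : ℝ) : ℂ) * SchwartzMap.derivCLM ℂ ℂ q ξ +
        d * (Complex.exp (Complex.I * (ζ : ℂ) * (ξ : ℂ)) *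
        ((Real.exp (d * β ξ) : ℝ) : ℂ) * tmul (deriv fun x => (β x : ℂ)) q ξ))) ξ := by
    intro ξ
    have h1 : HasDerivAt (fun ξ : ℝ => Complex.exp (Complex.I * (ζ : ℂ) * (ξ : ℂ)))
        (Complex.exp (Complex.I * (ζ : ℂ) * (ξ : ℂ)) * (Complex.I * ζ * 1)) ξ :=
      ((Complex.ofRealCLM.hasDerivAt (x := ξ)).const_mul (Complex.I * (ζ : ℂ))).cexp
    have h2 : HasDerivAt (fun ξ : ℝ => ((Real.exp (d * β ξ) : ℝ) : ℂ))
        (((Real.exp (d * β ξ) : ℝ) : ℂ) * (d * deriv (fun x => (β x : ℂ)) ξ)) ξ := by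
      simp only [Complex.ofReal_exp, Complex.ofReal_mul]
      exact ((hb ξ).hasDerivAt.const_mul (d : ℂ)).cexp
    have h3 : HasDerivAt q (SchwartzMap.derivCLM ℂ ℂ q ξ) ξ := by
      rw [SchwartzMap.derivCLM_apply]
      exact (q.differentiable ξ).hasDerivAt
    convert! (h1.mul h2).mul h3 using 1
    rw [tmul_apply H.temperate.deriv]
    simp only [Pi.mul_apply]
    ring
  have i1 := H.integrable q ζ hd
  have i2 := H.integrable (SchwartzMap.derivCLM ℂ ℂ q) ζ hd
  have i3 := H.integrable (tmul (deriv fun x => (β x : ℂ)) q) ζ hd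
  have h0 := integral_eq_zero_of_hasDerivAt_of_integrable hder
    ((i1.const_mul _).add (i2.add (i3.const_mul _))) i1
  have h1 := integral_add (i1.const_mul (Complex.I * ζ)) (i2.add (i3.const_mul (d : ℂ)))
  have h2 := integral_add i2 (i3.const_mul (d : ℂ))
  rw [integral_const_mul] at h1 h2
  simp only [Pi.add_apply] at h1
  rw [h0, h2] at h1
  unfold osc
  linear_combination -h1

theorem osc_decay (H : OscAdmissible β D K m) (n : ℕ) (q : SchwartzMap ℝ ℂ) :
    ∃ C, 0 ≤ C ∧ ∀ d ∈ D, ∀ ζ, |ζ| ^ n * ‖osc β q ζ d‖ ≤ C * (1 + |d|) ^ n * K d := by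
  induction n generalizing q with
  | zero =>
    refine ⟨∫ ξ, (1 + |ξ|) ^ m * ‖q ξ‖, integral_nonneg fun ξ => by positivity, fun d hd ζ => ?_⟩
    simpa [mul_comm] using H.norm_osc_le q ζ hd
  | succ n ih =>
    obtain ⟨C₁, h₁, hC₁⟩ := ih (SchwartzMap.derivCLM ℂ ℂ q)
    obtain ⟨C₂, h₂, hC₂⟩ := ih (tmul (deriv fun x => (β x : ℂ)) q)
    refine ⟨C₁ + C₂, add_nonneg h₁ h₂, fun d hd ζ => ?_⟩
    have hK := H.nonneg hd
    have e : |ζ| * ‖osc β q ζ d‖ = ‖Complex.I * ζ * osc β q ζ d‖ := by simp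
    calc |ζ| ^ (n + 1) * ‖osc β q ζ d‖ = |ζ| ^ n * ‖Complex.I * ζ * osc β q ζ d‖ := by
          rw [← e]; ring
      _ ≤ |ζ| ^ n * (‖osc β (SchwartzMap.derivCLM ℂ ℂ q) ζ d‖ +
            |d| * ‖osc β (tmul (deriv fun x => (β x : ℂ)) q) ζ d‖) := by
          rw [H.osc_by_parts q ζ hd]
          gcongr
          refine (norm_sub_le _ _).trans (le_of_eq ?_)
          simp
      _ = |ζ| ^ n * ‖osc β (SchwartzMap.derivCLM ℂ ℂ q) ζ d‖ +
            |d| * (|ζ| ^ n * ‖osc β (tmul (deriv fun x => (β x : ℂ)) q) ζ d‖) := by ring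
      _ ≤ C₁ * (1 + |d|) ^ n * K d + |d| * (C₂ * (1 + |d|) ^ n * K d) := by
          exact add_le_add (hC₁ d hd ζ) (mul_le_mul_of_nonneg_left (hC₂ d hd ζ) (abs_nonneg d))
      _ ≤ (C₁ + C₂) * (1 + |d|) ^ (n + 1) * K d := by
          have : 0 ≤ (1 + |d|) ^ n * K d := by positivity
          have h3 : 0 ≤ C₁ * |d| * ((1 + |d|) ^ n * K d) := by positivity
          have h4 : 0 ≤ C₂ * ((1 + |d|) ^ n * K d) := by positivity
          rw [pow_succ]
          nlinarith

theorem hasDerivAt_osc (H : OscAdmissible β D K m) (q : SchwartzMap ℝ ℂ)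
    {ζ d ζ' d' : ℝ → ℝ} (hζ : ∀ x, HasDerivAt ζ (ζ' x) x) (hd : ∀ x, HasDerivAt d (d' x) x)
    (hζ' : Continuous ζ') (hd' : Continuous d') (hD : ∀ x, d x ∈ D) (x : ℝ) :
    HasDerivAt (fun x => osc β q (ζ x) (d x))
      (ζ' x * osc β (tmul (fun ξ => Complex.I * ξ) q) (ζ x) (d x) +
        d' x * osc β (tmul (fun ξ => (β ξ : ℂ)) q) (ζ x) (d x)) x := by
  set q₁ := tmul (fun ξ => Complex.I * ξ) q with hq₁
  set q₂ := tmul (fun ξ => (β ξ : ℂ)) q with hq₂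
  have hdc : Continuous d := continuous_iff_continuousAt.2 fun x => (hd x).continuousAt
  have hKd : Continuous fun x => K (d x) := H.continuous_bound.comp hdc
  have hs : Set.Icc (x - 1) (x + 1) ∈ nhds x := Icc_mem_nhds (by linarith) (by linarith)
  obtain ⟨A, hA⟩ := isCompact_Icc.exists_bound_of_continuousOn
    (s := Set.Icc (x - 1) (x + 1)) (hζ'.mul hKd).continuousOn
  obtain ⟨B, hB⟩ := isCompact_Icc.exists_bound_of_continuousOn
    (s := Set.Icc (x - 1) (x + 1)) (hd'.mul hKd).continuousOn
  have key := hasDerivAt_integral_of_dominated_loc_of_deriv_le (μ := volume)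
    (F := fun x ξ : ℝ => Complex.exp (Complex.I * (ζ x : ℂ) * (ξ : ℂ)) *
        ((Real.exp (d x * β ξ) : ℝ) : ℂ) * q ξ)
    (F' := fun x ξ : ℝ => ζ' x * (Complex.exp (Complex.I * (ζ x : ℂ) * (ξ : ℂ)) *
        ((Real.exp (d x * β ξ) : ℝ) : ℂ) * q₁ ξ) + d' x *
        (Complex.exp (Complex.I * (ζ x : ℂ) * (ξ : ℂ)) *
        ((Real.exp (d x * β ξ) : ℝ) : ℂ) * q₂ ξ))
    (bound := fun ξ => A * ((1 + |ξ|) ^ m * ‖q₁ ξ‖) + B * ((1 + |ξ|) ^ m * ‖q₂ ξ‖))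
    hs (Filter.Eventually.of_forall fun x =>
      (H.continuous_integrand q.continuous _ _).aestronglyMeasurable)
    (H.integrable q _ (hD x))
    (((H.integrable q₁ _ (hD x)).const_mul _).add
      ((H.integrable q₂ _ (hD x)).const_mul _)).aestronglyMeasurable
    (Filter.Eventually.of_forall fun ξ y hy => ?_)
    (((q₁.rapidDecay.integrable_pow_mul_norm q₁.continuous.aestronglyMeasurable m).const_mul A).add
      ((q₂.rapidDecay.integrable_pow_mul_norm q₂.continuous.aestronglyMeasurable m).const_mul B))
    (Filter.Eventually.of_forall fun ξ y hy => ?_)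
  · have := key.2
    rw [integral_add ((H.integrable q₁ _ (hD x)).const_mul _)
      ((H.integrable q₂ _ (hD x)).const_mul _), integral_const_mul, integral_const_mul] at this
    exact this
  · have h1 := hA y hy
    have h2 := hB y hy
    simp only [Pi.mul_apply] at h1 h2
    rw [norm_mul, Real.norm_of_nonneg (H.nonneg (hD y))] at h1 h2
    refine (norm_add_le _ _).trans ?_
    rw [norm_mul (ζ' y : ℂ), norm_mul (d' y : ℂ), Complex.norm_real, Complex.norm_real]
    gcongr ?_ + ?_
    · calc _ ≤ ‖ζ' y‖ * (K (d y) * ((1 + |ξ|) ^ m * ‖q₁ ξ‖)) := by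
            gcongr; exact H.norm_integrand_le q₁ _ (hD y) ξ
        _ = (‖ζ' y‖ * K (d y)) * ((1 + |ξ|) ^ m * ‖q₁ ξ‖) := by ring
        _ ≤ _ := by gcongr
    · calc _ ≤ ‖d' y‖ * (K (d y) * ((1 + |ξ|) ^ m * ‖q₂ ξ‖)) := by
            gcongr; exact H.norm_integrand_le q₂ _ (hD y) ξ
        _ = (‖d' y‖ * K (d y)) * ((1 + |ξ|) ^ m * ‖q₂ ξ‖) := by ring
        _ ≤ _ := by gcongr
  · have h1 : HasDerivAt (fun x : ℝ => Complex.exp (Complex.I * (ζ x : ℂ) * (ξ : ℂ)))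
        (Complex.exp (Complex.I * (ζ y : ℂ) * (ξ : ℂ)) * (Complex.I * ζ' y * ξ)) y :=
      (((hζ y).ofReal_comp.const_mul Complex.I).mul_const (ξ : ℂ)).cexp
    have h2 : HasDerivAt (fun x : ℝ => ((Real.exp (d x * β ξ) : ℝ) : ℂ))
        (((Real.exp (d y * β ξ) : ℝ) : ℂ) * (d' y * β ξ)) y := by
      simp only [Complex.ofReal_exp, Complex.ofReal_mul]
      exact ((hd y).ofReal_comp.mul_const (β ξ : ℂ)).cexp
    convert! (h1.mul h2).mul_const (q ξ) using 1
    rw [hq₁, hq₂, tmul_apply H.temperate, tmul_apply (hasTemperateGrowth_I_mul _)]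
    ring

/-- Oscillatory integrals along a curve `(σx, α(x))`, with `α` of sublinear growth, are Schwartz
functions. -/
theorem exists_schwartzMap_osc (H : OscAdmissible β D K m) {σ : ℝ} (hσ : σ ≠ 0) {α : ℝ → ℝ}
    (hα : (fun x => (α x : ℂ)).HasTemperateGrowth) (hD : ∀ x, α x ∈ D)
    {C₁ C₂ : ℝ} {k : ℕ} (hα2 : ∀ x, (1 + |α x|) ^ 2 ≤ C₁ * (1 + |x|))
    (hK : ∀ x, K (α x) ≤ C₂ * (1 + |x|) ^ k) (q : SchwartzMap ℝ ℂ) :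
    ∃ p : SchwartzMap ℝ ℂ, ∀ x, p x = osc β q (σ * x) (α x) := by
  refine TemperateSpan.exists_schwartzMap
    (G := fun (q : SchwartzMap ℝ ℂ) (x : ℝ) => osc β q (σ * x) (α x)) ?_ ?_ (.base q)
  · intro q
    refine .of_pow_mul_le fun n => ?_
    obtain ⟨C, hC0, hC⟩ := H.osc_decay (2 * (n + k)) q
    obtain ⟨C', hC0', hC'⟩ := H.osc_decay 0 q
    have hC₁ : 0 ≤ C₁ := by
      have := (sq_nonneg _).trans (hα2 0)
      simpa using this
    have hC₂ : 0 ≤ C₂ := by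
      have := (H.nonneg (hD 0)).trans (hK 0)
      simpa using this
    have hσ' : 0 < |σ| := abs_pos.2 hσ
    refine ⟨max (C' * (C₂ * 2 ^ k)) (C * (C₁ ^ (n + k) * C₂) * 2 ^ (n + 2 * k) /
      |σ| ^ (2 * (n + k))), fun x => ?_⟩
    rcases le_total |x| 1 with hx | hx
    · refine le_max_of_le_left ?_
      have h := hC' (α x) (hD x) (σ * x)
      simp only [pow_zero, one_mul, mul_one] at h
      calc |x| ^ n * ‖osc β q (σ * x) (α x)‖ ≤ 1 * (C' * K (α x)) := by
            gcongr
            exact pow_le_one₀ (abs_nonneg x) hx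
        _ ≤ 1 * (C' * (C₂ * (1 + |x|) ^ k)) := by gcongr; exact hK x
        _ ≤ 1 * (C' * (C₂ * 2 ^ k)) := by gcongr; linarith
        _ = _ := one_mul _
    · refine le_max_of_le_right ?_
      have hx0 : 0 < |x| := by linarith
      have h := hC (α x) (hD x) (σ * x)
      rw [abs_mul, mul_pow] at h
      rw [le_div_iff₀ (by positivity)]
      have h2 : (1 + |α x|) ^ (2 * (n + k)) * K (α x) ≤
          C₁ ^ (n + k) * C₂ * (2 ^ (n + 2 * k) * |x| ^ (n + 2 * k)) := by
        calc (1 + |α x|) ^ (2 * (n + k)) * K (α x)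
            ≤ (C₁ * (1 + |x|)) ^ (n + k) * (C₂ * (1 + |x|) ^ k) := by
              rw [pow_mul]
              have := H.nonneg (hD x)
              gcongr
              exacts [hα2 x, hK x]
          _ = C₁ ^ (n + k) * C₂ * (1 + |x|) ^ (n + 2 * k) := by rw [mul_pow]; ring
          _ ≤ C₁ ^ (n + k) * C₂ * (2 * |x|) ^ (n + 2 * k) := by gcongr; linarith
          _ = _ := by rw [mul_pow]
      have h3 : (|x| ^ n * ‖osc β q (σ * x) (α x)‖ * |σ| ^ (2 * (n + k))) * |x| ^ (n + 2 * k) ≤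
          (C * (C₁ ^ (n + k) * C₂) * 2 ^ (n + 2 * k)) * |x| ^ (n + 2 * k) := by
        calc _ = |σ| ^ (2 * (n + k)) * |x| ^ (2 * (n + k)) * ‖osc β q (σ * x) (α x)‖ := by ring
          _ ≤ C * ((1 + |α x|) ^ (2 * (n + k)) * K (α x)) := by rw [← mul_assoc]; exact h
          _ ≤ C * (C₁ ^ (n + k) * C₂ * (2 ^ (n + 2 * k) * |x| ^ (n + 2 * k))) := by gcongr
          _ = _ := by ring
      exact le_of_mul_le_mul_right h3 (by positivity)
  · intro q
    have hdiff : Differentiable ℝ fun x => (α x : ℂ) := hα.1.differentiable (by simp)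
    have hd : ∀ x, HasDerivAt α ((deriv fun x => (α x : ℂ)) x).re x := fun x => by
      have := (Complex.reCLM.hasFDerivAt.comp_hasDerivAt x (hdiff x).hasDerivAt)
      exact this
    have hdd : ∀ x, ((((deriv fun x => (α x : ℂ)) x).re : ℝ) : ℂ) = (deriv fun x => (α x : ℂ)) x :=
      fun x => by rw [((hd x).ofReal_comp).deriv]; simp
    refine ⟨_, ((TemperateSpan.base (tmul (fun ξ => Complex.I * ξ) q)).mul
      (Function.HasTemperateGrowth.const (σ : ℂ))).add
      ((TemperateSpan.base (tmul (fun ξ => (β ξ : ℂ)) q)).mul hα.deriv), fun x => ?_⟩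
    have h := H.hasDerivAt_osc q (ζ := fun x => σ * x) (ζ' := fun _ => σ) (d := α)
      (d' := fun x => ((deriv fun x => (α x : ℂ)) x).re)
      (fun x => by simpa using (hasDerivAt_id x).const_mul σ) hd continuous_const
      (Complex.continuous_re.comp hα.deriv.1.continuous) hD x
    rw [hdd] at h
    exact h

end OscAdmissible

theorem Function.HasTemperateGrowth.of_deriv_ofReal {β β' : ℝ → ℝ}
    (hd : ∀ x, HasDerivAt β (β' x) x) (h' : (fun x => (β' x : ℂ)).HasTemperateGrowth)
    {C : ℝ} {k : ℕ} (hb : ∀ x, |β x| ≤ C * (1 + |x|) ^ k) :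
    (fun x => (β x : ℂ)).HasTemperateGrowth := by
  have hd' : ∀ x, HasDerivAt (fun x => (β x : ℂ)) (β' x : ℂ) x := fun x => (hd x).ofReal_comp
  refine .of_fderiv (k := k) (C := C) ?_ (fun x => (hd' x).differentiableAt) (by simpa using hb)
  have e : fderiv ℝ (fun x => (β x : ℂ)) =
      fun x => ContinuousLinearMap.toSpanSingletonCLE (𝕜 := ℝ) ((β' x : ℂ)) :=
    funext fun x => (hd' x).hasFDerivAt.fderiv
  rw [e]
  exact (ContinuousLinearMap.hasTemperateGrowth
    ((ContinuousLinearMap.toSpanSingletonCLE (𝕜 := ℝ) (E := ℂ)).toContinuousLinearMap)).comp h'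

theorem exp_abs_arsinh_le (x : ℝ) : Real.exp |Real.arsinh x| ≤ 1 + 2 * |x| := by
  have key : ∀ y : ℝ, 0 ≤ y → Real.exp (Real.arsinh y) ≤ 1 + 2 * y := fun y hy => by
    rw [Real.exp_arsinh]
    have : √(1 + y ^ 2) ≤ 1 + y := by
      rw [Real.sqrt_le_left (by positivity)]
      nlinarith
    linarith
  rcases le_total 0 x with hx | hx
  · rw [abs_of_nonneg (Real.arsinh_nonneg_iff.2 hx), abs_of_nonneg hx]
    exact key x hx
  · rw [abs_of_nonpos (Real.arsinh_nonpos_iff.2 hx), abs_of_nonpos hx, ← Real.arsinh_neg]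
    exact key (-x) (by linarith)

theorem arsinh_hasTemperateGrowth : (fun x => (Real.arsinh x : ℂ)).HasTemperateGrowth := by
  have h1 : (fun x : ℝ => (√(1 + x ^ 2))⁻¹).HasTemperateGrowth := by
    convert! Function.hasTemperateGrowth_one_add_norm_sq_rpow ℝ (-(1 / 2)) using 2 with x
    rw [Real.rpow_neg (by positivity), Real.sqrt_eq_rpow, Real.norm_eq_abs, sq_abs]
  have h2 : (fun x : ℝ => (((√(1 + x ^ 2))⁻¹ : ℝ) : ℂ)).HasTemperateGrowth :=
    Function.Complex.hasTemperateGrowth_ofReal.comp h1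
  refine .of_deriv_ofReal Real.hasDerivAt_arsinh h2 (C := 2) (k := 1) fun x => ?_
  have h := (Real.add_one_le_exp |Real.arsinh x|).trans (exp_abs_arsinh_le x)
  linarith [abs_nonneg x]

theorem one_add_sq_le_exp {s : ℝ} (hs : 0 ≤ s) : (1 + s) ^ 2 ≤ 4 * Real.exp s := by
  have h := Real.add_one_le_exp (s / 2)
  have e : Real.exp s = Real.exp (s / 2) ^ 2 := by rw [← Real.exp_nat_mul]; congr 1; push_cast; ring
  rw [e]
  nlinarith [Real.exp_pos (s / 2)]

theorem integral_jb_inv (x : ℝ) : ∫ y in (0:ℝ)..x, (jb y)⁻¹ = Real.arsinh x := by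
  have hc : Continuous fun y => (jb y)⁻¹ := by
    unfold jb
    exact (by fun_prop : Continuous fun y : ℝ => √(1 + y ^ 2)).inv₀ fun y => by positivity
  have h := intervalIntegral.integral_eq_sub_of_hasDerivAt
    (fun y _ => Real.hasDerivAt_arsinh y) (hc.intervalIntegrable 0 x)
  rwa [Real.arsinh_zero, sub_zero] at h

/-- The Fourier transform `û(ξ) = ∫ e^{-iyξ} u(y) dy`. -/
def hat (u : ℝ → ℂ) (ξ : ℝ) : ℂ := ∫ y : ℝ, Complex.exp (-Complex.I * (y : ℂ) * (ξ : ℂ)) * u y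

theorem hat_inversion (u : SchwartzMap ℝ ℂ) (x : ℝ) :
    ∫ ξ : ℝ, Complex.exp (Complex.I * (x : ℂ) * (ξ : ℂ)) * hat u ξ = 2 * Real.pi * u x := by
  have hF : ∀ w : ℝ, (FourierTransform.fourier u : SchwartzMap ℝ ℂ) w =
      hat u (2 * Real.pi * w) := fun w => by
    rw [SchwartzMap.fourier_coe, Real.fourier_real_eq_integral_exp_smul]
    unfold hat
    congr 1
    ext y
    rw [smul_eq_mul]
    congr 2
    push_cast
    ring
  have h1 : u x = ∫ w : ℝ, Complex.exp (Complex.I * (x : ℂ) * ((2 * Real.pi * w : ℝ) : ℂ)) *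
      hat u (2 * Real.pi * w) := by
    have h2 : u x = FourierTransformInv.fourierInv
        ((FourierTransform.fourier u : SchwartzMap ℝ ℂ) : ℝ → ℂ) x := by
      rw [← SchwartzMap.fourierInv_coe, FourierTransform.fourierInv_fourier_eq]
    rw [h2, Real.fourierInv_eq']
    congr 1
    ext w
    rw [smul_eq_mul, hF]
    congr 2
    simp only [RCLike.inner_apply, conj_trivial]
    push_cast
    ring
  rw [h1, Measure.integral_comp_mul_left
    (fun ξ : ℝ => Complex.exp (Complex.I * (x : ℂ) * (ξ : ℂ)) * hat u ξ) (2 * Real.pi)]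
  have hp : (Real.pi : ℂ) ≠ 0 := by exact_mod_cast Real.pi_ne_zero
  rw [abs_of_pos (by positivity), Complex.real_smul]
  push_cast
  field_simp

theorem hat_inversion' (v : SchwartzMap ℝ ℂ) (ξ : ℝ) :
    ∫ x : ℝ, Complex.exp (-Complex.I * (x : ℂ) * (ξ : ℂ)) *
      (∫ η : ℝ, Complex.exp (Complex.I * (x : ℂ) * (η : ℂ)) * v η) = 2 * Real.pi * v ξ := by
  rw [← hat_inversion, ← integral_neg_eq_self]
  congr 1
  ext x
  unfold hat
  push_cast
  congr 2
  · ring_nf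
  · ext η
    ring_nf

/-- Smooth functions bounded by one and constant beyond `±R`. -/
structure Cutoff (a : ℝ → ℝ) (R : ℝ) : Prop where
  contDiff : ContDiff ℝ (⊤ : ℕ∞) a
  abs_le_one : ∀ ξ, |a ξ| ≤ 1
  eq_of_ge : ∀ ξ₁ ξ₂, R ≤ ξ₁ → R ≤ ξ₂ → a ξ₁ = a ξ₂
  eq_of_le : ∀ ξ₁ ξ₂, ξ₁ ≤ -R → ξ₂ ≤ -R → a ξ₁ = a ξ₂

namespace Cutoff

variable {a : ℝ → ℝ} {R : ℝ}

theorem continuous (ha : Cutoff a R) : Continuous a := ha.contDiff.continuous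

theorem differentiable (ha : Cutoff a R) : Differentiable ℝ a :=
  ha.contDiff.differentiable (by simp)

theorem comp_div (ha : Cutoff a R) {h : ℝ} (hh : 0 < h) : Cutoff (fun ξ => a (ξ / h)) (R * h) where
  contDiff := ha.contDiff.comp (contDiff_id.div_const h)
  abs_le_one ξ := ha.abs_le_one _
  eq_of_ge ξ₁ ξ₂ h₁ h₂ := ha.eq_of_ge _ _ ((le_div_iff₀ hh).2 h₁) ((le_div_iff₀ hh).2 h₂)
  eq_of_le ξ₁ ξ₂ h₁ h₂ := ha.eq_of_le _ _ ((div_le_iff₀ hh).2 (by linarith))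
    ((div_le_iff₀ hh).2 (by linarith))

theorem deriv_eq_zero (ha : Cutoff a R) {ξ : ℝ} (hξ : R < |ξ|) : deriv a ξ = 0 := by
  rcases lt_abs.1 hξ with h | h
  · have : a =ᶠ[nhds ξ] fun _ => a ξ := by
      filter_upwards [Ioi_mem_nhds h] with y hy
      exact ha.eq_of_ge _ _ (le_of_lt hy) h.le
    rw [this.deriv_eq, deriv_const]
  · have h' : ξ < -R := by linarith
    have : a =ᶠ[nhds ξ] fun _ => a ξ := by
      filter_upwards [Iio_mem_nhds h'] with y hy
      exact ha.eq_of_le _ _ (le_of_lt hy) h'.le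
    rw [this.deriv_eq, deriv_const]

theorem hasCompactSupport_deriv (ha : Cutoff a R) :
    HasCompactSupport fun ξ => ((deriv a ξ : ℝ) : ℂ) := by
  refine HasCompactSupport.intro (isCompact_Icc (a := -R) (b := R)) fun ξ hξ => ?_
  rw [ha.deriv_eq_zero, Complex.ofReal_zero]
  by_contra! h
  exact hξ (abs_le.1 h)

theorem contDiff_deriv (ha : Cutoff a R) :
    ContDiff ℝ (⊤ : ℕ∞) fun ξ => ((deriv a ξ : ℝ) : ℂ) :=
  Complex.ofRealCLM.contDiff.comp (contDiff_infty_iff_deriv.1 ha.contDiff).2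

/-- The derivative of a cutoff symbol, as a Schwartz function. -/
def derivSchwartz (ha : Cutoff a R) : SchwartzMap ℝ ℂ :=
  ha.hasCompactSupport_deriv.toSchwartzMap ha.contDiff_deriv

theorem derivSchwartz_apply (ha : Cutoff a R) (ξ : ℝ) :
    ha.derivSchwartz ξ = ((deriv a ξ : ℝ) : ℂ) := rfl

theorem hasTemperateGrowth (ha : Cutoff a R) : (fun ξ => (a ξ : ℂ)).HasTemperateGrowth :=
  .of_deriv_ofReal (fun ξ => (ha.differentiable ξ).hasDerivAt)
    (ha.hasCompactSupport_deriv.hasTemperateGrowth ha.contDiff_deriv) (C := 1) (k := 0)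
    (by simpa using ha.abs_le_one)

theorem exists_lipschitz (ha : Cutoff a R) : ∃ L : ℝ, 0 ≤ L ∧ ∀ ξ η, |a ξ - a η| ≤ L * |ξ - η| := by
  obtain ⟨C, hC⟩ := ha.derivSchwartz.rapidDecay 0
  refine ⟨max C 0, le_max_right _ _, fun ξ η => ?_⟩
  refine Convex.norm_image_sub_le_of_norm_deriv_le (s := Set.univ) (fun x _ => ha.differentiable x)
    (fun x _ => ?_) convex_univ trivial trivial
  refine le_max_of_le_left ?_
  have h := hC x
  rw [ha.derivSchwartz_apply, Complex.norm_real] at h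
  simpa using h

theorem oscAdmissible (ha : Cutoff a R) :
    OscAdmissible a Set.univ (fun d => Real.exp |d|) 0 where
  temperate := ha.hasTemperateGrowth
  continuous_bound := by fun_prop
  exp_le d _ ξ := by
    rw [pow_zero, mul_one, Real.exp_le_exp]
    calc d * a ξ ≤ |d * a ξ| := le_abs_self _
      _ = |d| * |a ξ| := abs_mul _ _
      _ ≤ |d| * 1 := by gcongr; exact ha.abs_le_one ξ
      _ = |d| := mul_one _

end Cutoff

theorem exp_mul_abs_arsinh_le (M x : ℝ) :
    Real.exp (M * |Real.arsinh x|) ≤ 2 ^ ⌈M⌉₊ * (1 + |x|) ^ ⌈M⌉₊ := by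
  calc Real.exp (M * |Real.arsinh x|) ≤ Real.exp (⌈M⌉₊ * |Real.arsinh x|) := by
        gcongr; exact Nat.le_ceil M
    _ = Real.exp |Real.arsinh x| ^ ⌈M⌉₊ := by rw [← Real.exp_nat_mul]
    _ ≤ (2 * (1 + |x|)) ^ ⌈M⌉₊ := by
        gcongr; linarith [exp_abs_arsinh_le x]
    _ = _ := by rw [mul_pow]

theorem oscAdmissible_arsinh (M : ℝ) :
    OscAdmissible Real.arsinh (Set.Icc (-M) M) (fun _ => 2 ^ ⌈M⌉₊) ⌈M⌉₊ where
  temperate := arsinh_hasTemperateGrowth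
  continuous_bound := continuous_const
  exp_le d hd ξ := by
    refine le_trans ?_ (exp_mul_abs_arsinh_le M ξ)
    rw [Real.exp_le_exp]
    calc d * Real.arsinh ξ ≤ |d * Real.arsinh ξ| := le_abs_self _
      _ = |d| * |Real.arsinh ξ| := abs_mul _ _
      _ ≤ M * |Real.arsinh ξ| := by gcongr; exact abs_le.2 hd

theorem one_add_abs_mul_arsinh_sq_le {M : ℝ} (hM : 0 ≤ M) (x : ℝ) :
    (1 + |M * Real.arsinh x|) ^ 2 ≤ 8 * (1 + M) ^ 2 * (1 + |x|) := by
  have h1 := (one_add_sq_le_exp (abs_nonneg (Real.arsinh x))).trans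
    (mul_le_mul_of_nonneg_left (exp_abs_arsinh_le x) (by norm_num))
  calc (1 + |M * Real.arsinh x|) ^ 2 ≤ ((1 + M) * (1 + |Real.arsinh x|)) ^ 2 := by
        rw [abs_mul, abs_of_nonneg hM]
        gcongr
        nlinarith [abs_nonneg (Real.arsinh x)]
    _ = (1 + M) ^ 2 * (1 + |Real.arsinh x|) ^ 2 := by rw [mul_pow]
    _ ≤ (1 + M) ^ 2 * (4 * (1 + 2 * |x|)) := by gcongr
    _ ≤ (1 + M) ^ 2 * (8 * (1 + |x|)) :=
        mul_le_mul_of_nonneg_left (by linarith [abs_nonneg x]) (sq_nonneg _)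
    _ = _ := by ring

theorem temperate_const_mul_ofReal (c : ℝ) {b : ℝ → ℝ}
    (hb : (fun x => (b x : ℂ)).HasTemperateGrowth) :
    (fun x => ((c * b x : ℝ) : ℂ)).HasTemperateGrowth := by
  simp only [Complex.ofReal_mul]
  exact (Function.HasTemperateGrowth.const (c : ℂ)).mul hb

section Operators

variable {a : ℝ → ℝ} {R M : ℝ}

theorem exists_schwartzMap_osc_fwd (ha : Cutoff a R) (hM : 0 ≤ M) (v : SchwartzMap ℝ ℂ) :
    ∃ p : SchwartzMap ℝ ℂ, ∀ x, p x = osc a v x (M * Real.arsinh x) := by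
  have h := ha.oscAdmissible.exists_schwartzMap_osc one_ne_zero
    (α := fun x => M * Real.arsinh x) (temperate_const_mul_ofReal M arsinh_hasTemperateGrowth)
    (fun _ => trivial) (one_add_abs_mul_arsinh_sq_le hM)
    (fun x => by simpa [abs_mul, abs_of_nonneg hM] using exp_mul_abs_arsinh_le M x) v
  simpa only [one_mul] using h

theorem exists_schwartzMap_osc_bwd (ha : Cutoff a R) (hM : 0 ≤ M) (g : SchwartzMap ℝ ℂ) :
    ∃ p : SchwartzMap ℝ ℂ, ∀ ξ, p ξ = osc Real.arsinh g (-ξ) (-M * a ξ) := by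
  have hb : ∀ ξ, |-M * a ξ| ≤ M := fun ξ => by
    rw [abs_mul, abs_neg, abs_of_nonneg hM]
    exact mul_le_of_le_one_right hM (ha.abs_le_one ξ)
  have h := (oscAdmissible_arsinh M).exists_schwartzMap_osc (σ := -1) (by norm_num)
    (α := fun ξ => -M * a ξ) (temperate_const_mul_ofReal (-M) ha.hasTemperateGrowth)
    (fun ξ => abs_le.1 (hb ξ)) (C₁ := (1 + M) ^ 2) (C₂ := 2 ^ ⌈M⌉₊) (k := 0)
    (fun ξ => by
      have h1 : (1 + |-M * a ξ|) ^ 2 ≤ (1 + M) ^ 2 := by gcongr; exact hb ξ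
      nlinarith [mul_nonneg (sq_nonneg (1 + M)) (abs_nonneg ξ)])
    (fun ξ => by simp) g
  simpa only [neg_mul, one_mul] using h

theorem hat_eq_osc (u : ℝ → ℂ) (ξ : ℝ) : hat u ξ = osc Real.arsinh u (-ξ) 0 := by
  unfold hat osc
  congr 1
  ext y
  simp only [zero_mul, Real.exp_zero, Complex.ofReal_one, mul_one, Complex.ofReal_neg]
  congr 2
  ring

theorem exists_schwartzMap_hat (u : SchwartzMap ℝ ℂ) :
    ∃ p : SchwartzMap ℝ ℂ, ∀ ξ, p ξ = hat u ξ := by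
  have hc : Cutoff (fun _ => 0) 0 := ⟨contDiff_const, by simp, by simp, by simp⟩
  obtain ⟨p, hp⟩ := exists_schwartzMap_osc_bwd hc le_rfl u
  exact ⟨p, fun ξ => by rw [hp, hat_eq_osc]; simp⟩

/-- The Fourier transform as a map on Schwartz functions. -/
def hatS (u : SchwartzMap ℝ ℂ) : SchwartzMap ℝ ℂ := (exists_schwartzMap_hat u).choose

theorem hatS_apply (u : SchwartzMap ℝ ℂ) (ξ : ℝ) : hatS u ξ = hat u ξ :=
  (exists_schwartzMap_hat u).choose_spec ξ

theorem coe_hatS (u : SchwartzMap ℝ ℂ) : (hatS u : ℝ → ℂ) = hat u := funext (hatS_apply u)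

theorem osc_zero_eq (β : ℝ → ℝ) (v : ℝ → ℂ) (x : ℝ) :
    osc β v x 0 = ∫ ξ : ℝ, Complex.exp (Complex.I * (x : ℂ) * (ξ : ℂ)) * v ξ := by
  simp [osc]

theorem hat_osc_zero (β : ℝ → ℝ) (v : SchwartzMap ℝ ℂ) (ξ : ℝ) :
    hat (fun x => osc β v x 0) ξ = 2 * Real.pi * v ξ := by
  simp_rw [osc_zero_eq]
  exact hat_inversion' v ξ

theorem exists_hatS_eq (v : SchwartzMap ℝ ℂ) : ∃ u : SchwartzMap ℝ ℂ, hatS u = v := by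
  have hc : Cutoff (fun _ => 0) 0 := ⟨contDiff_const, by simp, by simp, by simp⟩
  obtain ⟨p, hp⟩ := exists_schwartzMap_osc_fwd hc le_rfl v
  refine ⟨((2 * Real.pi)⁻¹ : ℂ) • p, SchwartzMap.ext fun ξ => ?_⟩
  have h := hat_osc_zero (fun _ => 0) v ξ
  have hpi : (Real.pi : ℂ) ≠ 0 := by exact_mod_cast Real.pi_ne_zero
  have e : hat (((2 * Real.pi)⁻¹ : ℂ) • p : SchwartzMap ℝ ℂ) ξ =
      (2 * Real.pi : ℂ)⁻¹ * hat (fun x => osc (fun _ => 0) v x 0) ξ := by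
    unfold hat
    rw [← integral_const_mul]
    congr 1
    ext y
    rw [smul_apply, hp, zero_mul, smul_eq_mul]
    ring
  rw [hatS_apply, e, h]
  field_simp

theorem hatS_injective {u : SchwartzMap ℝ ℂ} (h : hatS u = 0) : u = 0 := by
  ext x
  have h1 := hat_inversion u x
  rw [← coe_hatS, h] at h1
  have hpi : (Real.pi : ℂ) ≠ 0 := by exact_mod_cast Real.pi_ne_zero
  simpa [hpi] using h1.symm

theorem psdo1_eq (h : ℝ) (ω : ℝ → ℝ) (u : ℝ → ℂ) (x : ℝ) :
    psdo1 (fun x' ξ' => ((Real.exp (M * ω (ξ' / h) * ∫ y in (0:ℝ)..x', (jb y)⁻¹) : ℝ) : ℂ)) u x =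
      ((2 * Real.pi)⁻¹ : ℝ) * osc (fun ξ => ω (ξ / h)) (hat u) x (M * Real.arsinh x) := by
  unfold psdo1 osc
  simp only [integral_jb_inv]
  congr 2
  ext ξ
  rw [show M * ω (ξ / h) * Real.arsinh x = M * Real.arsinh x * ω (ξ / h) by ring]
  rfl

end Operators

theorem Complex.norm_exp_sub_one_le_mul_exp_abs_re (w : ℂ) :
    ‖Complex.exp w - 1‖ ≤ Real.exp |w.re| * ‖w‖ := by
  have h := Convex.norm_image_sub_le_of_norm_deriv_le (f := Complex.exp) (C := Real.exp |w.re|)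
    (s := {z : ℂ | z.re ≤ |w.re|}) (x := 0) (y := w)
    (fun z _ => Complex.differentiable_exp z)
    (fun z hz => by
      rw [Complex.deriv_exp, Complex.norm_exp]
      exact Real.exp_le_exp.2 hz)
    (convex_halfSpace_re_le _) (by simp) (show w.re ≤ |w.re| from le_abs_self _)
  simpa using h

theorem Complex.norm_cosh_le (w : ℂ) : ‖Complex.cosh w‖ ≤ Real.cosh w.re := by
  rw [Complex.cosh, Real.cosh_eq, norm_div, ← Complex.norm_exp w, ← Complex.neg_re,
    ← Complex.norm_exp (-w), Complex.norm_ofNat]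
  gcongr
  exact norm_add_le _ _

theorem Real.exp_abs_le_two_mul_cosh (x : ℝ) : Real.exp |x| ≤ 2 * Real.cosh x := by
  rw [← Real.cosh_abs, Real.cosh_eq]
  linarith [Real.exp_pos (-|x|)]

theorem Real.abs_le_cosh (x : ℝ) : |x| ≤ Real.cosh x := by
  rw [← Real.cosh_abs, Real.cosh_eq]
  have h := Real.add_one_le_exp (-|x|)
  have h2 : (1 + |x|) ^ 2 ≤ 4 * Real.exp |x| := one_add_sq_le_exp (abs_nonneg x)
  have h3 := Real.quadratic_le_exp_of_nonneg (abs_nonneg x)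
  nlinarith [Real.exp_pos (-|x|), sq_nonneg (|x| - 1), sq_nonneg (|x| - 2)]

theorem rapidDecay_exp_neg_mul_abs {b : ℝ} (hb : 0 < b) :
    RapidDecay fun x => ((Real.exp (-b * |x|) : ℝ) : ℂ) := by
  intro n
  refine ⟨n.factorial / b ^ n * Real.exp b, fun x => ?_⟩
  rw [Complex.norm_real, Real.norm_of_nonneg (Real.exp_pos _).le]
  have h := Real.pow_div_factorial_le_exp (b * (1 + |x|)) (by positivity) n
  rw [div_le_iff₀ (by positivity), mul_pow] at h
  have e : Real.exp (-b * |x|) = Real.exp b * (Real.exp (b * (1 + |x|)))⁻¹ := by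
    rw [← Real.exp_neg, ← Real.exp_add]; congr 1; ring
  rw [e]
  have : (1 + |x|) ^ n * (Real.exp (b * (1 + |x|)))⁻¹ ≤ n.factorial / b ^ n := by
    rw [le_div_iff₀ (by positivity), ← div_eq_mul_inv, div_mul_eq_mul_div,
      div_le_iff₀ (Real.exp_pos _)]
    linarith
  calc _ = ((1 + |x|) ^ n * (Real.exp (b * (1 + |x|)))⁻¹) * Real.exp b := by ring
    _ ≤ _ := by gcongr

theorem integrable_pow_mul_exp_neg_mul_abs {b : ℝ} (hb : 0 < b) (n : ℕ) :
    Integrable fun x : ℝ => (1 + |x|) ^ n * Real.exp (-b * |x|) := by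
  have h := (rapidDecay_exp_neg_mul_abs hb).integrable_pow_mul_norm
    (by fun_prop : Continuous fun x : ℝ => ((Real.exp (-b * |x|) : ℝ) : ℂ)).aestronglyMeasurable n
  simpa only [Complex.norm_real, Real.norm_of_nonneg (Real.exp_pos _).le] using h

theorem integrable_abs_add_two_div_cosh : Integrable fun θ : ℝ => (|θ| + 2) / Real.cosh θ := by
  refine ((integrable_pow_mul_exp_neg_mul_abs one_pos 1).const_mul 4).mono'
    (Continuous.aestronglyMeasurable ?_) (Filter.Eventually.of_forall fun θ => ?_)
  · exact (by fun_prop : Continuous fun θ : ℝ => |θ| + 2).div Real.continuous_cosh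
      fun θ => (Real.cosh_pos θ).ne'
  · have hc := Real.cosh_pos θ
    rw [Real.norm_of_nonneg (by positivity), div_le_iff₀ hc, neg_one_mul, Real.exp_neg, pow_one]
    have h := Real.exp_abs_le_two_mul_cosh θ
    have h1 : 1 ≤ (Real.exp |θ|)⁻¹ * (2 * Real.cosh θ) := by
      rw [inv_mul_eq_div, one_le_div (Real.exp_pos _)]; exact h
    have h2 : (0:ℝ) ≤ 2 + 2 * |θ| := by positivity
    nlinarith [mul_le_mul_of_nonneg_left h1 h2, abs_nonneg θ]

/-- Powers of `cosh` are negligible with respect to `exp (-b cosh)`. -/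
theorem exists_cosh_pow_mul_exp_le {b : ℝ} (hb : 0 < b) (n : ℕ) :
    ∃ C, 0 ≤ C ∧ ∀ θ : ℝ, Real.cosh θ ^ n * Real.exp (-b * Real.cosh θ) ≤ C / Real.cosh θ := by
  refine ⟨(n + 1).factorial / b ^ (n + 1), by positivity, fun θ => ?_⟩
  have hc := Real.cosh_pos θ
  have h := Real.pow_div_factorial_le_exp (b * Real.cosh θ) (by positivity) (n + 1)
  rw [div_le_iff₀ (by positivity), mul_pow] at h
  rw [le_div_iff₀ hc, le_div_iff₀ (by positivity), neg_mul, Real.exp_neg]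
  calc Real.cosh θ ^ n * (Real.exp (b * Real.cosh θ))⁻¹ * Real.cosh θ * b ^ (n + 1)
      = (b ^ (n + 1) * Real.cosh θ ^ (n + 1)) / Real.exp (b * Real.cosh θ) := by
        rw [pow_succ (Real.cosh θ)]; field_simp
    _ ≤ _ := by rw [div_le_iff₀ (Real.exp_pos _)]; linarith

theorem integrable_cosh_pow_mul_exp {b : ℝ} (hb : 0 < b) (n : ℕ) :
    Integrable fun θ : ℝ => Real.cosh θ ^ n * Real.exp (-b * Real.cosh θ) := by
  obtain ⟨C, hC0, hC⟩ := exists_cosh_pow_mul_exp_le hb n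
  refine (integrable_abs_add_two_div_cosh.const_mul C).mono'
    (Continuous.aestronglyMeasurable (by fun_prop)) (Filter.Eventually.of_forall fun θ => ?_)
  have hc := Real.cosh_pos θ
  rw [Real.norm_of_nonneg (by positivity)]
  refine (hC θ).trans ?_
  rw [← mul_div_assoc]
  gcongr
  nlinarith [abs_nonneg θ]

/-- The line of integration of a function holomorphic and uniformly small at infinity in a
horizontal strip can be moved. -/
theorem integral_add_mul_I_eq {f : ℂ → ℂ} (hf : Differentiable ℂ f) {α : ℝ} {g : ℝ → ℝ}
    (hg : Integrable g) (hg0 : Filter.Tendsto g (Filter.cocompact ℝ) (nhds 0))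
    (hfg : ∀ θ s : ℝ, |s| ≤ |α| → ‖f (θ + s * Complex.I)‖ ≤ g θ) :
    ∫ θ : ℝ, f (θ + α * Complex.I) = ∫ θ : ℝ, f θ := by
  have h_int : ∀ s : ℝ, |s| ≤ |α| → Integrable fun θ : ℝ => f (θ + s * Complex.I) := fun s hs =>
    hg.mono' ((hf.continuous.comp (by fun_prop)).aestronglyMeasurable)
      (Filter.Eventually.of_forall fun θ => hfg θ s hs)
  have hlim : ∀ s : ℝ, |s| ≤ |α| → Filter.Tendsto
      (fun T : ℝ => ∫ θ in (-T)..T, f (θ + s * Complex.I)) Filter.atTop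
      (nhds (∫ θ : ℝ, f (θ + s * Complex.I))) := fun s hs =>
    intervalIntegral_tendsto_integral (h_int s hs) Filter.tendsto_neg_atTop_atBot Filter.tendsto_id
  have h0 := hlim 0 (by simp)
  have h1 := hlim α le_rfl
  simp only [Complex.ofReal_zero, zero_mul, add_zero] at h0
  have hrect : ∀ T : ℝ, (∫ θ in (-T)..T, f (θ + α * Complex.I)) - ∫ θ in (-T)..T, f θ =
      Complex.I * (∫ s in (0:ℝ)..α, f (T + s * Complex.I)) -
        Complex.I * ∫ s in (0:ℝ)..α, f (((-T : ℝ) : ℂ) + s * Complex.I) := fun T => by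
    have h := Complex.integral_boundary_rect_eq_zero_of_differentiableOn f ((-T : ℝ) : ℂ)
      (T + α * Complex.I) hf.differentiableOn
    simp only [Complex.ofReal_re, Complex.ofReal_im, Complex.add_re, Complex.add_im,
      Complex.mul_re, Complex.mul_im, Complex.I_re, Complex.I_im, mul_zero, mul_one, sub_zero,
      zero_add, add_zero, smul_eq_mul, Complex.ofReal_zero, zero_mul] at h
    linear_combination -h
  have hv : ∀ σ : ℝ, σ ≠ 0 → Filter.Tendsto
      (fun T : ℝ => ∫ s in (0:ℝ)..α, f (((σ * T : ℝ) : ℂ) + s * Complex.I)) Filter.atTop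
      (nhds 0) := fun σ hσ => by
    have ht : Filter.Tendsto (fun T : ℝ => σ * T) Filter.atTop (Filter.cocompact ℝ) := by
      rw [cocompact_eq_atBot_atTop]
      rcases lt_or_gt_of_ne hσ with h | h
      · exact (Filter.tendsto_id.const_mul_atTop_of_neg h).mono_right le_sup_left
      · exact (Filter.tendsto_id.const_mul_atTop h).mono_right le_sup_right
    refine squeeze_zero_norm (a := fun T => g (σ * T) * |α|) (fun T => ?_) ?_
    · have := intervalIntegral.norm_integral_le_of_norm_le_const (a := (0:ℝ)) (b := α)
        (f := fun s : ℝ => f (((σ * T : ℝ) : ℂ) + s * Complex.I)) (C := g (σ * T))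
        fun s hs => hfg _ s ?_
      · simpa using this
      · rw [Set.mem_uIoc] at hs
        rcases hs with hs | hs
        · rw [abs_of_pos hs.1]; exact hs.2.trans (le_abs_self _)
        · rw [abs_of_nonpos hs.2]; linarith [neg_abs_le α]
    · simpa using (hg0.comp ht).mul_const |α|
  have h2 := (hv 1 one_ne_zero).const_mul Complex.I
  have h3 := (hv (-1) (by norm_num)).const_mul Complex.I
  have h4 := h2.sub h3
  simp only [one_mul, neg_one_mul, mul_zero, sub_zero] at h4
  have h5 := h1.sub h0
  simp only [hrect] at h5
  exact sub_eq_zero.1 (tendsto_nhds_unique h5 h4)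

/-- The regularised Fourier integral `∫ e^{-iτx} e^{-ε⟨x⟩} e^{ν arsinh x} dx`. -/
def regInt (ε τ ν : ℝ) : ℂ :=
  ∫ x : ℝ, Complex.exp (-Complex.I * τ * x) *
    ((Real.exp (-ε * √(1 + x ^ 2) + ν * Real.arsinh x) : ℝ) : ℂ)

theorem Complex.cosh_add_mul_I_eq (θ α : ℝ) : Complex.cosh (θ + α * Complex.I) =
    Real.cosh θ * Real.cos α + Real.sinh θ * Real.sin α * Complex.I := by
  rw [Complex.cosh_add, Complex.cosh_mul_I, Complex.sinh_mul_I]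
  push_cast
  ring

theorem regInt_eq_integral_sinh (ρ α ν : ℝ) :
    regInt (ρ * Real.cos α) (ρ * Real.sin α) ν =
      ∫ θ : ℝ, Complex.exp (-ρ * Complex.cosh (θ + α * Complex.I)) * Complex.exp (ν * θ) *
        Complex.cosh θ := by
  unfold regInt
  have h := integral_image_eq_integral_abs_deriv_smul (s := Set.univ) MeasurableSet.univ
    (fun θ _ => (Real.hasDerivAt_sinh θ).hasDerivWithinAt) Real.sinh_injective.injOn
    (fun x : ℝ => Complex.exp (-Complex.I * ((ρ * Real.sin α : ℝ) : ℂ) * x) *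
    ((Real.exp (-(ρ * Real.cos α) * √(1 + x ^ 2) + ν * Real.arsinh x) : ℝ) : ℂ))
  rw [Set.image_univ, Real.sinh_surjective.range_eq, setIntegral_univ, setIntegral_univ] at h
  rw [h]
  congr 1
  ext θ
  rw [Real.arsinh_sinh, ← Real.cosh_arsinh, Real.arsinh_sinh, abs_of_pos (Real.cosh_pos θ),
    Complex.real_smul, Complex.cosh_add_mul_I_eq, mul_comm]
  rw [Complex.ofReal_exp, ← Complex.exp_add, ← Complex.exp_add, Complex.ofReal_cosh]
  congr 2
  push_cast
  ring

theorem neg_mul_cosh_strip_re_le {ρ α θ s : ℝ} (hρ : 0 ≤ ρ) (hα : |α| ≤ Real.pi / 2)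
    (hs : |s| ≤ |α|) :
    (-ρ * Complex.cosh (θ + s * Complex.I)).re ≤ -(ρ * Real.cos α) * Real.cosh θ := by
  rw [Complex.cosh_add_mul_I_eq]
  have h : Real.cos α ≤ Real.cos s := by
    rw [← Real.cos_abs α, ← Real.cos_abs s]
    exact Real.cos_le_cos_of_nonneg_of_le_pi (abs_nonneg s) (by linarith [Real.pi_pos]) hs
  have e : (-ρ * (Real.cosh θ * Real.cos s + Real.sinh θ * Real.sin s * Complex.I) : ℂ).re =
      -ρ * (Real.cosh θ * Real.cos s) := by
    simp only [← Complex.ofReal_mul, ← Complex.ofReal_neg]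
    rw [Complex.re_ofReal_mul, Complex.add_re, Complex.ofReal_re, Complex.re_ofReal_mul]
    simp
  rw [e]
  have h2 := mul_le_mul_of_nonneg_left h (mul_nonneg hρ (Real.cosh_pos θ).le)
  linarith

theorem norm_shift_integrand_le {ρ α ν θ s : ℝ} (hρ : 0 ≤ ρ) (hα : |α| ≤ Real.pi / 2)
    (hs : |s| ≤ |α|) :
    ‖Complex.exp (-ρ * Complex.cosh (θ + s * Complex.I)) *
      Complex.exp (ν * (θ + s * Complex.I - α * Complex.I)) *
      Complex.cosh (θ + s * Complex.I - α * Complex.I)‖ ≤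
    2 ^ ⌈|ν|⌉₊ * (Real.cosh θ ^ (⌈|ν|⌉₊ + 1) *
      Real.exp (-(ρ * Real.cos α) * Real.cosh θ)) := by
  set k := ⌈|ν|⌉₊ with hk
  have hc := Real.cosh_pos θ
  rw [norm_mul, norm_mul, Complex.norm_exp, Complex.norm_exp]
  have h1 := neg_mul_cosh_strip_re_le (θ := θ) hρ hα hs
  have e2 : (ν * (θ + s * Complex.I - α * Complex.I) : ℂ).re = ν * θ := by
    rw [Complex.re_ofReal_mul]; simp
  have e3 : (θ + s * Complex.I - α * Complex.I : ℂ).re = θ := by simp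
  have h3 := Complex.norm_cosh_le (θ + s * Complex.I - α * Complex.I)
  rw [e3] at h3
  rw [e2]
  have h2 : Real.exp (ν * θ) ≤ 2 ^ k * Real.cosh θ ^ k := by
    calc Real.exp (ν * θ) ≤ Real.exp (k * |θ|) := by
          rw [Real.exp_le_exp]
          calc ν * θ ≤ |ν * θ| := le_abs_self _
            _ = |ν| * |θ| := abs_mul _ _
            _ ≤ k * |θ| := by gcongr; exact Nat.le_ceil _
      _ = Real.exp |θ| ^ k := by rw [← Real.exp_nat_mul]
      _ ≤ (2 * Real.cosh θ) ^ k := by gcongr; exact Real.exp_abs_le_two_mul_cosh θ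
      _ = _ := by rw [mul_pow]
  calc _ ≤ Real.exp (-(ρ * Real.cos α) * Real.cosh θ) * (2 ^ k * Real.cosh θ ^ k) *
        Real.cosh θ := by gcongr
    _ = _ := by ring

theorem regInt_eq_integral_shift {ρ α ν : ℝ} (hρ : 0 < ρ) (hα : |α| < Real.pi / 2) :
    regInt (ρ * Real.cos α) (ρ * Real.sin α) ν =
      ∫ θ : ℝ, Complex.exp (-ρ * Complex.cosh θ) * Complex.exp (ν * (θ - α * Complex.I)) *
        Complex.cosh (θ - α * Complex.I) := by
  have hcos : 0 < Real.cos α := Real.cos_pos_of_mem_Ioo (abs_lt.1 hα)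
  have hb : 0 < ρ * Real.cos α := mul_pos hρ hcos
  set k := ⌈|ν|⌉₊ with hk
  set g : ℝ → ℝ := fun θ => 2 ^ k * (Real.cosh θ ^ (k + 1) *
    Real.exp (-(ρ * Real.cos α) * Real.cosh θ)) with hg
  rw [regInt_eq_integral_sinh]
  have key := integral_add_mul_I_eq (f := fun w : ℂ => Complex.exp (-ρ * Complex.cosh w) *
      Complex.exp (ν * (w - α * Complex.I)) * Complex.cosh (w - α * Complex.I)) (α := α) (g := g)
      ?_ ((integrable_cosh_pow_mul_exp hb (k + 1)).const_mul _) ?_ ?_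
  · simpa using key
  · have : Differentiable ℂ Complex.cosh := Complex.differentiable_cosh
    fun_prop
  · obtain ⟨C, hC0, hC⟩ := exists_cosh_pow_mul_exp_le hb (k + 1)
    refine squeeze_zero (g := fun θ : ℝ => 2 ^ k * (C * (Real.cosh θ)⁻¹)) (fun θ => ?_)
      (fun θ => mul_le_mul_of_nonneg_left (hC θ) (by positivity)) ?_
    · have := Real.cosh_pos θ
      positivity
    · have h : Filter.Tendsto Real.cosh (Filter.cocompact ℝ) Filter.atTop :=
        Filter.tendsto_atTop_mono Real.abs_le_cosh (tendsto_norm_cocompact_atTop (E := ℝ))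
      simpa using (h.inv_tendsto_atTop.const_mul C).const_mul (2 ^ k)
  · exact fun θ s hs => norm_shift_integrand_le hρ.le hα.le hs

/-- Majorant of `regInt ε τ ν - regInt ε τ 0`, uniform in `ε`. -/
def regMajorant (τ : ℝ) : ℝ := ∫ θ : ℝ, (|θ| + 2) * Real.exp (-(|τ| / 4) * Real.cosh θ)

theorem integrable_uncurry_regMajorant : Integrable
    (Function.uncurry fun θ τ : ℝ => (|θ| + 2) * Real.exp (-(|τ| / 4) * Real.cosh θ))
    (volume.prod volume) := by
  have hc : Continuous (Function.uncurry fun θ τ : ℝ =>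
      (|θ| + 2) * Real.exp (-(|τ| / 4) * Real.cosh θ)) := by
    unfold Function.uncurry
    fun_prop
  have hi : ∀ b : ℝ, 0 < b → Integrable fun τ : ℝ => Real.exp (-b * |τ|) := fun b hb => by
    simpa using integrable_pow_mul_exp_neg_mul_abs hb 0
  rw [integrable_prod_iff hc.aestronglyMeasurable]
  constructor
  · refine Filter.Eventually.of_forall fun θ => ?_
    have h := (hi (Real.cosh θ / 4) (by have := Real.cosh_pos θ; positivity)).const_mul (|θ| + 2)
    refine h.congr (Filter.Eventually.of_forall fun τ => ?_)
    simp only [Function.uncurry]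
    ring_nf
  · refine (integrable_abs_add_two_div_cosh.const_mul 8).congr
      (Filter.Eventually.of_forall fun θ => ?_)
    have hθ := Real.cosh_pos θ
    have e : ∀ τ : ℝ, ‖Function.uncurry (fun θ τ : ℝ =>
        (|θ| + 2) * Real.exp (-(|τ| / 4) * Real.cosh θ)) (θ, τ)‖ =
        (|θ| + 2) * Real.exp (-(Real.cosh θ / 4) * |τ|) := fun τ => by
      simp only [Function.uncurry]
      rw [Real.norm_of_nonneg (by positivity)]
      ring_nf
    simp only [e]
    rw [integral_const_mul, integral_comp_abs (f := fun t => Real.exp (-(Real.cosh θ / 4) * t)),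
      integral_exp_mul_Ioi (by linarith)]
    simp
    field_simp
    norm_num

theorem integrable_regMajorant : Integrable regMajorant := by
  exact integrable_uncurry_regMajorant.integral_prod_right

theorem regMajorant_nonneg (τ : ℝ) : 0 ≤ regMajorant τ :=
  integral_nonneg fun θ => by positivity

theorem norm_regInt_sub_le {ε τ ν c : ℝ} (hε : 0 < ε) (hc0 : 0 ≤ c) (hc : c ≤ 1 / 2)
    (hν : |ν| ≤ c * |τ|) :
    ‖regInt ε τ ν - regInt ε τ 0‖ ≤ 4 * c * regMajorant τ := by
  rcases eq_or_ne τ 0 with rfl | hτ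
  · have h0 : ν = 0 := by simpa using hν
    rw [h0, sub_self, norm_zero]
    exact mul_nonneg (by positivity) (regMajorant_nonneg _)
  set z : ℂ := ⟨ε, τ⟩ with hz
  set ρ := ‖z‖ with hρ
  set α := Complex.arg z with hα
  have h1 : ρ * Real.cos α = ε := Complex.norm_mul_cos_arg z
  have h2 : ρ * Real.sin α = τ := Complex.norm_mul_sin_arg z
  have hα' : |α| < Real.pi / 2 := Complex.abs_arg_lt_pi_div_two_iff.2 (Or.inl hε)
  have hρτ : |τ| ≤ ρ := Complex.abs_im_le_norm z
  have hτ' : 0 < |τ| := abs_pos.2 hτ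
  have hρ0 : 0 < ρ := hτ'.trans_le hρτ
  have hα2 : |α| ≤ 2 := by linarith [Real.pi_le_four]
  have hI : ∀ ν : ℝ, Integrable fun θ : ℝ => Complex.exp (-ρ * Complex.cosh θ) *
      Complex.exp (ν * (θ - α * Complex.I)) * Complex.cosh (θ - α * Complex.I) := fun ν => by
    have hcont := Complex.continuous_cosh
    refine ((integrable_cosh_pow_mul_exp (h1 ▸ hε) (⌈|ν|⌉₊ + 1)).const_mul (2 ^ ⌈|ν|⌉₊)).mono'
      (Continuous.aestronglyMeasurable (by fun_prop)) (Filter.Eventually.of_forall fun θ => ?_)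
    simpa using norm_shift_integrand_le (θ := θ) (ν := ν) (s := 0) hρ0.le hα'.le (by simp)
  rw [← h1, ← h2, regInt_eq_integral_shift hρ0 hα', regInt_eq_integral_shift hρ0 hα',
    ← integral_sub (hI ν) (hI 0), h2, regMajorant, ← integral_const_mul]
  refine norm_integral_le_of_norm_le ?_ (Filter.Eventually.of_forall fun θ => ?_)
  · refine Integrable.const_mul ?_ _
    refine ((integrable_cosh_pow_mul_exp (div_pos hτ' four_pos) 1).const_mul 3).mono'
      (Continuous.aestronglyMeasurable (by fun_prop)) (Filter.Eventually.of_forall fun θ => ?_)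
    rw [Real.norm_of_nonneg (by positivity), ← mul_assoc]
    gcongr
    linarith [Real.abs_le_cosh θ, Real.one_le_cosh θ]
  have hcθ := Real.cosh_pos θ
  have e : Complex.exp (-ρ * Complex.cosh θ) *
      Complex.exp (ν * (θ - α * Complex.I)) * Complex.cosh (θ - α * Complex.I) -
      Complex.exp (-ρ * Complex.cosh θ) *
      Complex.exp ((0 : ℝ) * (θ - α * Complex.I)) * Complex.cosh (θ - α * Complex.I) =
      Complex.exp (-ρ * Complex.cosh θ) * Complex.cosh (θ - α * Complex.I) *
        (Complex.exp (ν * (θ - α * Complex.I)) - 1) := by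
    simp only [Complex.ofReal_zero, zero_mul, Complex.exp_zero]
    ring
  rw [e, norm_mul, norm_mul, Complex.norm_exp]
  have e1 : (-ρ * Complex.cosh θ : ℂ).re = -(ρ * Real.cosh θ) := by
    rw [← Complex.ofReal_cosh, ← Complex.ofReal_neg, ← Complex.ofReal_mul, Complex.ofReal_re]
    ring
  have e2 : (ν * (θ - α * Complex.I) : ℂ).re = ν * θ := by
    rw [Complex.re_ofReal_mul]; simp
  have h3 := Complex.norm_cosh_le (θ - α * Complex.I)
  rw [show (θ - α * Complex.I : ℂ).re = θ by simp] at h3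
  have h4 := Complex.norm_exp_sub_one_le_mul_exp_abs_re (ν * (θ - α * Complex.I))
  rw [e2] at h4
  rw [e1]
  have h5 : |ν * θ| ≤ ρ * Real.cosh θ / 2 := by
    rw [abs_mul]
    calc |ν| * |θ| ≤ (c * |τ|) * Real.cosh θ := by gcongr; exact Real.abs_le_cosh θ
      _ ≤ (1 / 2 * ρ) * Real.cosh θ := by gcongr
      _ = _ := by ring
  have h6 : ‖(ν * (θ - α * Complex.I) : ℂ)‖ ≤ c * ρ * (|θ| + 2) := by
    rw [norm_mul, Complex.norm_real, Real.norm_eq_abs]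
    have : ‖(θ - α * Complex.I : ℂ)‖ ≤ |θ| + 2 := by
      refine (norm_sub_le _ _).trans ?_
      rw [norm_mul, Complex.norm_I, mul_one, Complex.norm_real, Complex.norm_real]
      exact add_le_add le_rfl hα2
    calc _ ≤ (c * |τ|) * (|θ| + 2) := by gcongr
      _ ≤ _ := by gcongr
  set s := ρ * Real.cosh θ with hs
  have hs0 : 0 < s := by positivity
  have h7 : s * Real.exp (-s) * Real.exp (s / 2) ≤ 4 * Real.exp (-(s / 4)) := by
    have := Real.add_one_le_exp (s / 4)
    have h8 : Real.exp (-s) * Real.exp (s / 2) = Real.exp (-(s / 4)) * (Real.exp (s / 4))⁻¹ := by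
      rw [← Real.exp_neg, ← Real.exp_add, ← Real.exp_add]; congr 1; ring
    rw [mul_assoc, h8, ← mul_assoc, mul_comm s, mul_assoc, mul_comm 4]
    gcongr
    rw [← div_eq_mul_inv, div_le_iff₀ (Real.exp_pos _)]
    linarith
  calc Real.exp (-s) * ‖Complex.cosh (θ - α * Complex.I)‖ *
        ‖Complex.exp (ν * (θ - α * Complex.I)) - 1‖
      ≤ Real.exp (-s) * Real.cosh θ * (Real.exp (s / 2) * (c * ρ * (|θ| + 2))) := by
        gcongr
        refine h4.trans ?_
        gcongr
    _ = c * (|θ| + 2) * (s * Real.exp (-s) * Real.exp (s / 2)) := by rw [hs]; ring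
    _ ≤ c * (|θ| + 2) * (4 * Real.exp (-(s / 4))) := by gcongr
    _ = 4 * c * ((|θ| + 2) * Real.exp (-(ρ / 4) * Real.cosh θ)) := by rw [hs]; ring_nf
    _ ≤ _ := by gcongr

theorem norm_cexp_neg_I_mul (x y : ℝ) : ‖Complex.exp (-Complex.I * (x : ℂ) * (y : ℂ))‖ = 1 := by
  simpa using norm_cexp_I_mul (-x) y

theorem integrable_regInt_kernel {ε B ξ : ℝ} (hε : 0 < ε) {b : ℝ → ℝ}
    (hb : Continuous b) (hbB : ∀ η, |b η| ≤ B) (v : SchwartzMap ℝ ℂ) :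
    Integrable (Function.uncurry fun η x : ℝ => v η *
      (Complex.exp (-Complex.I * ((ξ - η : ℝ) : ℂ) * x) *
        ((Real.exp (-ε * √(1 + x ^ 2) + b η * Real.arsinh x) : ℝ) : ℂ)))
      (volume.prod volume) := by
  have hv := v.continuous
  have hc : Continuous (Function.uncurry fun η x : ℝ => v η *
      (Complex.exp (-Complex.I * ((ξ - η : ℝ) : ℂ) * x) *
        ((Real.exp (-ε * √(1 + x ^ 2) + b η * Real.arsinh x) : ℝ) : ℂ))) := by
    have := Real.continuous_arsinh
    unfold Function.uncurry
    fun_prop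
  have h2 := (integrable_pow_mul_exp_neg_mul_abs hε ⌈B⌉₊).const_mul (2 ^ ⌈B⌉₊)
  refine ((v.integrable.norm).mul_prod h2).mono' hc.aestronglyMeasurable
    (Filter.Eventually.of_forall fun p => ?_)
  obtain ⟨η, x⟩ := p
  simp only [Function.uncurry]
  rw [norm_mul, norm_mul, norm_cexp_neg_I_mul, one_mul, Complex.norm_real,
    Real.norm_of_nonneg (Real.exp_pos _).le, Real.exp_add]
  refine mul_le_mul_of_nonneg_left ?_ (norm_nonneg _)
  calc _ ≤ Real.exp (-ε * |x|) * Real.exp (B * |Real.arsinh x|) := by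
        have h3 : |x| ≤ √(1 + x ^ 2) := Real.abs_le_sqrt (by linarith)
        have h4 : b η * Real.arsinh x ≤ B * |Real.arsinh x| := by
          refine (le_abs_self _).trans ?_
          rw [abs_mul]
          gcongr
          exact hbB η
        gcongr ?_ * ?_
        · rw [Real.exp_le_exp]; nlinarith
        · exact Real.exp_le_exp.2 h4
    _ ≤ Real.exp (-ε * |x|) * (2 ^ ⌈B⌉₊ * (1 + |x|) ^ ⌈B⌉₊) := by
        gcongr; exact exp_mul_abs_arsinh_le B x
    _ = _ := by ring

theorem integrable_mul_regInt {ε B ξ : ℝ} (hε : 0 < ε) {b : ℝ → ℝ}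
    (hb : Continuous b) (hbB : ∀ η, |b η| ≤ B) (v : SchwartzMap ℝ ℂ) :
    Integrable fun η => v η * regInt ε (ξ - η) (b η) := by
  have h := (integrable_regInt_kernel (ξ := ξ) hε hb hbB v).integral_prod_left
  simp only [Function.uncurry, integral_const_mul] at h
  exact h

theorem integral_mul_regInt {ε B ξ : ℝ} (hε : 0 < ε) {b : ℝ → ℝ}
    (hb : Continuous b) (hbB : ∀ η, |b η| ≤ B) (v : SchwartzMap ℝ ℂ) :
    ∫ η, v η * regInt ε (ξ - η) (b η) =
      ∫ x : ℝ, Complex.exp (-Complex.I * x * ξ) * ((Real.exp (-ε * √(1 + x ^ 2)) : ℝ) : ℂ) *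
        ∫ η : ℝ, Complex.exp (Complex.I * x * η) *
          ((Real.exp (b η * Real.arsinh x) : ℝ) : ℂ) * v η := by
  unfold regInt
  simp_rw [← integral_const_mul]
  rw [integral_integral_swap (integrable_regInt_kernel hε hb hbB v)]
  congr 1; ext x; congr 1; ext η
  rw [Real.exp_add, Complex.ofReal_mul]
  have : Complex.exp (-Complex.I * ((ξ - η : ℝ) : ℂ) * x) =
      Complex.exp (-Complex.I * x * ξ) * Complex.exp (Complex.I * x * η) := by
    rw [← Complex.exp_add]; congr 1; push_cast; ring
  rw [this]
  ring

theorem tendsto_regularized_hat {g : ℝ → ℂ} (hg : Integrable g) (ξ : ℝ) :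
    Filter.Tendsto (fun ε : ℝ => ∫ x : ℝ, Complex.exp (-Complex.I * x * ξ) *
      ((Real.exp (-ε * √(1 + x ^ 2)) : ℝ) : ℂ) * g x) (nhdsWithin 0 (Set.Ioi 0))
      (nhds (hat g ξ)) := by
  refine tendsto_integral_filter_of_dominated_convergence (fun x => ‖g x‖) ?_ ?_ hg.norm ?_
  · refine Filter.Eventually.of_forall fun ε => AEStronglyMeasurable.mul
      (Continuous.aestronglyMeasurable (by fun_prop)) hg.aestronglyMeasurable
  · filter_upwards [self_mem_nhdsWithin] with ε hε
    refine Filter.Eventually.of_forall fun x => ?_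
    rw [norm_mul, norm_mul, norm_cexp_neg_I_mul, one_mul, Complex.norm_real,
      Real.norm_of_nonneg (Real.exp_pos _).le]
    refine mul_le_of_le_one_left (norm_nonneg _) (Real.exp_le_one_iff.2 ?_)
    have : 0 ≤ ε * √(1 + x ^ 2) := mul_nonneg (le_of_lt hε) (Real.sqrt_nonneg _)
    linarith
  · refine Filter.Eventually.of_forall fun x => ?_
    have hc : Continuous fun ε : ℝ => Complex.exp (-Complex.I * x * ξ) *
      ((Real.exp (-ε * √(1 + x ^ 2)) : ℝ) : ℂ) * g x := by fun_prop
    have := (hc.tendsto 0).mono_left (nhdsWithin_le_nhds (s := Set.Ioi 0))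
    simpa using this

theorem eq_zero_of_osc_eq_zero {a : ℝ → ℝ} {R M c : ℝ} (ha : Cutoff a R) (hM : 0 ≤ M)
    (hc0 : 0 ≤ c) (hc : c ≤ 1 / 2) (hac : ∀ ξ η, M * |a ξ - a η| ≤ c * |ξ - η|)
    (hsmall : 4 * c * ∫ τ, regMajorant τ < 2 * Real.pi) (v : SchwartzMap ℝ ℂ)
    (hv : ∀ x, osc a v x (M * Real.arsinh x) = 0) : v = 0 := by
  obtain ⟨p, hp⟩ := exists_schwartzMap_osc_fwd ha le_rfl v
  have hp' : (p : ℝ → ℂ) = fun x => osc a v x 0 := by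
    funext x; rw [hp, zero_mul]
  obtain ⟨S, hS⟩ : ∃ S, ∀ ξ, ‖v ξ‖ ≤ S := by
    obtain ⟨S, hS⟩ := v.rapidDecay 0
    exact ⟨S, by simpa using hS⟩
  have key : ∀ T, (∀ ξ, ‖v ξ‖ ≤ T) → ∀ ξ,
      2 * Real.pi * ‖v ξ‖ ≤ 4 * c * (∫ τ, regMajorant τ) * T := by
    intro T hT ξ
    have lim := (tendsto_regularized_hat p.integrable ξ).norm
    rw [hp', hat_osc_zero] at lim
    have e : ‖(2 * Real.pi * v ξ : ℂ)‖ = 2 * Real.pi * ‖v ξ‖ := by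
      simp [abs_of_pos Real.pi_pos]
    rw [e] at lim
    refine le_of_tendsto lim ?_
    filter_upwards [self_mem_nhdsWithin] with ε hε
    have hε : 0 < ε := hε
    have hb1 : Continuous fun η => M * (a η - a ξ) := by
      have := ha.continuous
      fun_prop
    have hb2 : ∀ η, |M * (a η - a ξ)| ≤ 2 * M := fun η => by
      rw [abs_mul, abs_of_nonneg hM, mul_comm 2]
      gcongr
      linarith [abs_sub (a η) (a ξ), ha.abs_le_one η, ha.abs_le_one ξ]
    have h1 := integral_mul_regInt (ξ := ξ) hε hb1 hb2 v
    have h0 := integral_mul_regInt (ξ := ξ) (b := fun _ => 0) (B := 0) hε continuous_const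
      (by simp) v
    have i1 := integrable_mul_regInt (ξ := ξ) hε hb1 hb2 v
    have i0 := integrable_mul_regInt (ξ := ξ) (b := fun _ => 0) (B := 0) hε continuous_const
      (by simp) v
    have z : ∀ x : ℝ, (∫ η : ℝ, Complex.exp (Complex.I * x * η) *
          ((Real.exp (M * (a η - a ξ) * Real.arsinh x) : ℝ) : ℂ) * v η) = 0 := fun x => by
      have h := hv x
      unfold osc at h
      rw [← mul_zero ((Real.exp (-(M * a ξ * Real.arsinh x)) : ℝ) : ℂ), ← h,
        ← integral_const_mul]
      congr 1; ext η
      rw [show M * (a η - a ξ) * Real.arsinh x =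
        -(M * a ξ * Real.arsinh x) + M * Real.arsinh x * a η by ring, Real.exp_add]
      push_cast
      ring
    simp only [z, mul_zero, integral_zero] at h1
    simp only [zero_mul, Real.exp_zero, Complex.ofReal_one, mul_one] at h0
    simp only [osc_zero_eq]
    rw [← h0, ← sub_zero (∫ η, _), ← h1, ← integral_sub i0 i1]
    have hI : Integrable fun η => T * (4 * c * regMajorant (ξ - η)) :=
      ((integrable_regMajorant.comp_sub_left ξ).const_mul (4 * c)).const_mul T
    refine (norm_integral_le_of_norm_le hI (Filter.Eventually.of_forall fun η => ?_)).trans ?_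
    · rw [← mul_sub, norm_mul, norm_sub_rev]
      have hT0 := (norm_nonneg _).trans (hT η)
      gcongr
      · exact hT η
      · refine norm_regInt_sub_le hε hc0 hc ?_
        rw [abs_mul, abs_of_nonneg hM, abs_sub_comm]
        exact hac ξ η
    · rw [integral_const_mul, integral_const_mul, integral_sub_left_eq_self]
      linarith
  set θ := 4 * c * (∫ τ, regMajorant τ) / (2 * Real.pi) with hθ
  have hpi : 0 < 2 * Real.pi := by positivity
  have hθ1 : θ < 1 := (div_lt_one hpi).2 hsmall
  have hθ0 : 0 ≤ θ := div_nonneg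
    (mul_nonneg (by positivity) (integral_nonneg regMajorant_nonneg)) hpi.le
  have hn : ∀ n : ℕ, ∀ ξ, ‖v ξ‖ ≤ θ ^ n * S := by
    intro n
    induction n with
    | zero => simpa using hS
    | succ n ih =>
      intro ξ
      have h := key _ ih ξ
      have e : 4 * c * (∫ τ, regMajorant τ) = θ * (2 * Real.pi) := (div_mul_cancel₀ _ hpi.ne').symm
      rw [e] at h
      refine le_of_mul_le_mul_left (h.trans (le_of_eq ?_)) hpi
      ring
  ext ξ
  have hl : Filter.Tendsto (fun n : ℕ => θ ^ n * S) Filter.atTop (nhds 0) := by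
    simpa using (tendsto_pow_atTop_nhds_zero_of_lt_one hθ0 hθ1).mul_const S
  have := ge_of_tendsto' hl fun n => hn n ξ
  simpa using this

theorem exp_half_abs_arsinh_sub_le (x y : ℝ) :
    Real.exp (|Real.arsinh x - Real.arsinh y| / 2) ≤ 1 + |x - y| := by
  wlog h : y ≤ x generalizing x y
  · rw [abs_sub_comm, abs_sub_comm x]
    exact this y x (le_of_not_ge h)
  set n := (Real.arsinh x - Real.arsinh y) / 2 with hn
  set m := (Real.arsinh x + Real.arsinh y) / 2 with hm
  have hδ : 0 ≤ Real.arsinh x - Real.arsinh y := sub_nonneg.2 (Real.arsinh_le_arsinh.2 h)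
  have hn0 : 0 ≤ n := by positivity
  have e : x - y = 2 * (Real.cosh m * Real.sinh n) := by
    conv_lhs => rw [← Real.sinh_arsinh x, ← Real.sinh_arsinh y]
    rw [show Real.arsinh x = m + n by ring, show Real.arsinh y = m - n by ring,
      Real.sinh_add, Real.sinh_sub]
    ring
  rw [abs_of_nonneg hδ, abs_of_nonneg (sub_nonneg.2 h), e, ← hn, ← Real.cosh_add_sinh]
  have h1 : Real.cosh n ≤ 1 + Real.sinh n := by
    have h2 := Real.cosh_sub_sinh n
    have h3 : Real.exp (-n) ≤ 1 := Real.exp_le_one_iff.2 (by linarith)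
    linarith
  have h4 : 0 ≤ Real.sinh n := Real.sinh_nonneg_iff.2 hn0
  nlinarith [Real.one_le_cosh m]

theorem exp_mul_abs_arsinh_sub_le (M x y : ℝ) :
    Real.exp (M * |Real.arsinh x - Real.arsinh y|) ≤ (1 + |x - y|) ^ (2 * ⌈M⌉₊) := by
  calc Real.exp (M * |Real.arsinh x - Real.arsinh y|)
      ≤ Real.exp ((2 * ⌈M⌉₊ : ℕ) * (|Real.arsinh x - Real.arsinh y| / 2)) := by
        rw [Real.exp_le_exp]
        push_cast
        have := mul_le_mul_of_nonneg_right (Nat.le_ceil M)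
          (abs_nonneg (Real.arsinh x - Real.arsinh y))
        linarith
    _ ≤ _ := by
        rw [Real.exp_nat_mul]
        gcongr
        exact exp_half_abs_arsinh_sub_le x y

theorem one_add_abs_mul_arsinh_sub_sq_le {M : ℝ} (hM : 0 ≤ M) (x y : ℝ) :
    (1 + |M * (Real.arsinh x - Real.arsinh y)|) ^ 2 ≤ 16 * (1 + M) ^ 2 * (1 + |x - y|) := by
  set s := |Real.arsinh x - Real.arsinh y| with hs
  have hs0 : 0 ≤ s := abs_nonneg _
  have h1 := (one_add_sq_le_exp (div_nonneg hs0 zero_le_two)).trans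
    (mul_le_mul_of_nonneg_left (exp_half_abs_arsinh_sub_le x y) (by norm_num))
  calc (1 + |M * (Real.arsinh x - Real.arsinh y)|) ^ 2 ≤ (2 * (1 + M) * (1 + s / 2)) ^ 2 := by
        rw [abs_mul, abs_of_nonneg hM, ← hs]
        gcongr
        nlinarith [mul_nonneg hM hs0]
    _ = 4 * (1 + M) ^ 2 * (1 + s / 2) ^ 2 := by ring
    _ ≤ 4 * (1 + M) ^ 2 * (4 * (1 + |x - y|)) := by gcongr
    _ = _ := by ring

theorem osc_arsinh_sub_decay {a : ℝ → ℝ} {R M : ℝ} (ha : Cutoff a R) (hM : 0 ≤ M) (n : ℕ)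
    (q : SchwartzMap ℝ ℂ) : ∃ C, 0 ≤ C ∧ ∀ h, 1 ≤ h → ∀ x y,
      (1 + h * |x - y|) ^ n *
        ‖osc a q (h * (x - y)) (M * (Real.arsinh x - Real.arsinh y))‖ ≤ C := by
  set k := 2 * ⌈M⌉₊ with hk
  obtain ⟨C₁, h₁, hC₁⟩ := ha.oscAdmissible.osc_decay (2 * (n + k)) q
  obtain ⟨C₀, h₀, hC₀⟩ := ha.oscAdmissible.osc_decay 0 q
  set B := (16 * (1 + M) ^ 2) ^ (n + k) with hB
  refine ⟨2 ^ (2 * (n + k) - 1) * (C₀ + C₁ * B), by positivity, fun h hh x y => ?_⟩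
  set w := h * |x - y| with hw
  have hw0 : 0 ≤ w := by positivity
  have hzw : |x - y| ≤ w := le_mul_of_one_le_left (abs_nonneg _) hh
  set d := M * (Real.arsinh x - Real.arsinh y) with hd
  set o := ‖osc a q (h * (x - y)) d‖ with ho
  have ho0 : 0 ≤ o := norm_nonneg _
  have hE : Real.exp |d| ≤ (1 + w) ^ k := by
    rw [hd, abs_mul, abs_of_nonneg hM]
    refine (exp_mul_abs_arsinh_sub_le M x y).trans ?_
    gcongr
  have e0 : o ≤ C₀ * (1 + w) ^ k := by
    have := hC₀ d trivial (h * (x - y))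
    simp only [pow_zero, one_mul, mul_one] at this
    exact this.trans (by gcongr)
  have e1 : w ^ (2 * (n + k)) * o ≤ C₁ * B * (1 + w) ^ (n + 2 * k) := by
    have := hC₁ d trivial (h * (x - y))
    rw [abs_mul, abs_of_pos (by linarith : 0 < h), ← hw] at this
    refine this.trans ?_
    have h2 : (1 + |d|) ^ (2 * (n + k)) ≤ B * (1 + w) ^ (n + k) := by
      rw [pow_mul, hB, ← mul_pow]
      gcongr
      refine (one_add_abs_mul_arsinh_sub_sq_le hM x y).trans ?_
      gcongr
    calc C₁ * (1 + |d|) ^ (2 * (n + k)) * Real.exp |d|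
        ≤ C₁ * (B * (1 + w) ^ (n + k)) * (1 + w) ^ k := by gcongr
      _ = _ := by ring
  have e2 : (1 + w) ^ (2 * (n + k)) ≤ 2 ^ (2 * (n + k) - 1) * (1 + w ^ (2 * (n + k))) := by
    simpa using add_pow_le zero_le_one hw0 (2 * (n + k))
  have hpos : 0 < (1 + w) ^ (n + 2 * k) := by positivity
  refine le_of_mul_le_mul_right ?_ hpos
  calc (1 + w) ^ n * o * (1 + w) ^ (n + 2 * k) = (1 + w) ^ (2 * (n + k)) * o := by ring
    _ ≤ 2 ^ (2 * (n + k) - 1) * (1 + w ^ (2 * (n + k))) * o := by gcongr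
    _ = 2 ^ (2 * (n + k) - 1) * (o + w ^ (2 * (n + k)) * o) := by ring
    _ ≤ 2 ^ (2 * (n + k) - 1) * (C₀ * (1 + w) ^ (n + 2 * k) +
          C₁ * B * (1 + w) ^ (n + 2 * k)) := by
        gcongr
        refine e0.trans ?_
        gcongr
        · linarith
        · omega
    _ = _ := by ring

/-- The averages `∫₀¹ tᵏ b(y + t(x - y)) dt`. -/
def segAvg (b : ℝ → ℂ) (k : ℕ) (x y : ℝ) : ℂ :=
  ∫ t in (0:ℝ)..1, (t : ℂ) ^ k * b (y + t * (x - y))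

theorem continuous_segAvg {b : ℝ → ℂ} (hb : Continuous b) (k : ℕ) :
    Continuous (Function.uncurry (segAvg b k)) := by
  have : Continuous (Function.uncurry fun (p : ℝ × ℝ) (t : ℝ) =>
      (t : ℂ) ^ k * b (p.2 + t * (p.1 - p.2))) := by
    unfold Function.uncurry; fun_prop
  exact intervalIntegral.continuous_parametric_intervalIntegral_of_continuous' this 0 1

theorem norm_segAvg_le {b : ℝ → ℂ} {C : ℝ} {x y : ℝ} (k : ℕ)
    (hC : ∀ t, 0 ≤ t → t ≤ 1 → ‖b (y + t * (x - y))‖ ≤ C) : ‖segAvg b k x y‖ ≤ C := by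
  have := intervalIntegral.norm_integral_le_of_norm_le_const (a := 0) (b := 1) (C := C)
    (f := fun t : ℝ => (t : ℂ) ^ k * b (y + t * (x - y))) fun t ht => by
      rw [Set.uIoc_of_le zero_le_one] at ht
      rw [norm_mul, norm_pow, Complex.norm_real, Real.norm_of_nonneg ht.1.le]
      exact (mul_le_of_le_one_left (norm_nonneg _) (pow_le_one₀ ht.1.le ht.2)).trans
        (hC t ht.1.le ht.2)
  unfold segAvg
  simpa using this

theorem hasDerivAt_segAvg {b : ℝ → ℂ} (hb : ContDiff ℝ (⊤ : ℕ∞) b) (k : ℕ) (x y : ℝ) :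
    HasDerivAt (fun x => segAvg b k x y) (segAvg (deriv b) (k + 1) x y) x := by
  have hb' : Continuous (deriv b) := (contDiff_infty_iff_deriv.1 hb).2.continuous
  have hbd : Differentiable ℝ b := hb.differentiable (by simp)
  have hbc := hb.continuous
  obtain ⟨B, hB⟩ := (isCompact_Icc.prod isCompact_Icc).exists_bound_of_continuousOn
    (s := Set.Icc (x - 1) (x + 1) ×ˢ Set.Icc (0 : ℝ) 1)
    (f := fun p : ℝ × ℝ => (p.2 : ℂ) ^ (k + 1) * deriv b (y + p.2 * (p.1 - y)))
    (by fun_prop)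
  refine (intervalIntegral.hasDerivAt_integral_of_dominated_loc_of_deriv_le
    (F := fun (x t : ℝ) => (t : ℂ) ^ k * b (y + t * (x - y)))
    (F' := fun (x t : ℝ) => (t : ℂ) ^ (k + 1) * deriv b (y + t * (x - y)))
    (bound := fun _ => B) (s := Set.Icc (x - 1) (x + 1))
    (Icc_mem_nhds (by linarith) (by linarith))
    (Filter.Eventually.of_forall fun x => Continuous.aestronglyMeasurable (by fun_prop))
    (Continuous.intervalIntegrable (by fun_prop) _ _)
    (Continuous.aestronglyMeasurable (by fun_prop)) ?_ intervalIntegrable_const ?_).2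
  · refine Filter.Eventually.of_forall fun t ht x' hx' => ?_
    rw [Set.uIoc_of_le zero_le_one] at ht
    exact hB (x', t) ⟨hx', ht.1.le, ht.2⟩
  · refine Filter.Eventually.of_forall fun t _ x' _ => ?_
    have h1 : HasDerivAt (fun x' : ℝ => y + t * (x' - y)) t x' := by
      simpa using (((hasDerivAt_id x').sub_const y).const_mul t).const_add y
    have h2 := ((hbd (y + t * (x' - y))).hasDerivAt.scomp x' h1).const_mul ((t : ℂ) ^ k)
    convert! h2 using 1
    rw [Complex.real_smul]
    ring

/-- The kernels `(∫₀¹ tᵏ b(y + t(x - y)) dt)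
∫ e^{i(x-y)ξ} e^{M a(ξ)(arsinh x - arsinh y)} q(ξ) dξ`. -/
def oscKernel (a : ℝ → ℝ) (M : ℝ) (b : ℝ → ℂ) (k : ℕ) (q : ℝ → ℂ) (x y : ℝ) : ℂ :=
  segAvg b k x y * osc a q (x - y) (M * (Real.arsinh x - Real.arsinh y))

section

variable {a : ℝ → ℝ} {R M : ℝ} {b : ℝ → ℂ}

theorem one_add_abs_le_mul (x y : ℝ) : 1 + |x| ≤ (1 + |y|) * (1 + |x - y|) := by
  have h : |x| ≤ |y| + |x - y| := by simpa using abs_add_le y (x - y)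
  nlinarith [abs_nonneg y, abs_nonneg (x - y)]

theorem exists_oscKernel_bound (ha : Cutoff a R) (hM : 0 ≤ M) (hb : b.HasTemperateGrowth)
    (k : ℕ) (q : SchwartzMap ℝ ℂ) : ∃ m : ℕ, ∀ n : ℕ, ∃ C, ∀ x y,
      (1 + |x|) ^ n * ‖oscKernel a M b k q x y‖ ≤ C * (1 + |y|) ^ (n + m) := by
  obtain ⟨m, C, hC⟩ := hb.2 0
  simp only [norm_iteratedFDeriv_zero, Real.norm_eq_abs] at hC
  have hC0 : 0 ≤ C := by simpa using (norm_nonneg _).trans (hC 0)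
  refine ⟨m, fun n => ?_⟩
  obtain ⟨C', h0, hC'⟩ := osc_arsinh_sub_decay ha hM (n + m) q
  refine ⟨C * C', fun x y => ?_⟩
  have h1 : ‖segAvg b k x y‖ ≤ C * ((1 + |y|) * (1 + |x - y|)) ^ m := by
    refine norm_segAvg_le k fun t ht0 ht1 => (hC _).trans ?_
    gcongr
    have h2 : |y + t * (x - y)| ≤ |y| + |x - y| := by
      refine (abs_add_le _ _).trans ?_
      rw [abs_mul, abs_of_nonneg ht0]
      gcongr
      exact mul_le_of_le_one_left (abs_nonneg _) ht1
    nlinarith [abs_nonneg y, abs_nonneg (x - y)]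
  have h3 := hC' 1 le_rfl x y
  rw [one_mul, one_mul] at h3
  rw [oscKernel, norm_mul]
  calc _ ≤ ((1 + |y|) * (1 + |x - y|)) ^ n * ((C * ((1 + |y|) * (1 + |x - y|)) ^ m) *
        ‖osc a q (x - y) (M * (Real.arsinh x - Real.arsinh y))‖) := by
        gcongr; exact one_add_abs_le_mul x y
    _ = C * (1 + |y|) ^ (n + m) * ((1 + |x - y|) ^ (n + m) *
        ‖osc a q (x - y) (M * (Real.arsinh x - Real.arsinh y))‖) := by
        rw [mul_pow, mul_pow]; ring
    _ ≤ C * (1 + |y|) ^ (n + m) * C' := by gcongr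
    _ = _ := by ring

theorem continuous_oscKernel (ha : Cutoff a R) (hb : Continuous b) (k : ℕ)
    (q : SchwartzMap ℝ ℂ) (x : ℝ) : Continuous (oscKernel a M b k q x) := by
  have h1 : Continuous (segAvg b k x) :=
    (continuous_segAvg hb k).comp (f := fun y => (x, y)) (by fun_prop)
  refine h1.mul (continuous_iff_continuousAt.2 fun y => ?_)
  refine (ha.oscAdmissible.hasDerivAt_osc q (ζ := fun y => x - y)
    (d := fun y => M * (Real.arsinh x - Real.arsinh y)) (ζ' := fun _ => -1)
    (d' := fun y => M * -(√(1 + y ^ 2))⁻¹) (fun y => ?_) (fun y => ?_) continuous_const ?_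
    (fun _ => trivial) y).continuousAt
  · exact (hasDerivAt_id y).const_sub x
  · exact ((Real.hasDerivAt_arsinh y).const_sub _).const_mul M
  · exact continuous_const.mul ((Continuous.inv₀ (by fun_prop) fun y => by positivity).neg)

theorem hasDerivAt_oscKernel (ha : Cutoff a R) (hb : b.HasTemperateGrowth) (k : ℕ)
    (q : SchwartzMap ℝ ℂ) (x y : ℝ) : HasDerivAt (fun x => oscKernel a M b k q x y)
      (oscKernel a M (deriv b) (k + 1) q x y +
        (oscKernel a M b k (tmul (fun ξ => Complex.I * ξ) q) x y +
          ((M * (√(1 + x ^ 2))⁻¹ : ℝ) : ℂ) *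
            oscKernel a M b k (tmul (fun ξ => (a ξ : ℂ)) q) x y)) x := by
  have h1 := hasDerivAt_segAvg hb.1 k x y
  have h2 := ha.oscAdmissible.hasDerivAt_osc q (ζ := fun x => x - y)
    (d := fun x => M * (Real.arsinh x - Real.arsinh y)) (ζ' := fun _ => 1)
    (d' := fun x => M * (√(1 + x ^ 2))⁻¹) (fun x => (hasDerivAt_id x).sub_const y)
    (fun x => ((Real.hasDerivAt_arsinh x).sub_const _).const_mul M) continuous_const
    (continuous_const.mul (Continuous.inv₀ (by fun_prop) fun y => by positivity))
    (fun _ => trivial) x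
  convert! h1.mul h2 using 1
  unfold oscKernel
  push_cast
  ring

theorem deriv_ofReal_arsinh (x : ℝ) :
    deriv (fun x => (Real.arsinh x : ℂ)) x = (((√(1 + x ^ 2))⁻¹ : ℝ) : ℂ) :=
  (Real.hasDerivAt_arsinh x).ofReal_comp.deriv

theorem integrable_oscKernel_mul (ha : Cutoff a R) (hM : 0 ≤ M) (hb : b.HasTemperateGrowth)
    (k : ℕ) (q : SchwartzMap ℝ ℂ) {g : ℝ → ℂ} (hg : RapidDecay g) (hgc : Continuous g) (x : ℝ) :
    Integrable fun y => oscKernel a M b k q x y * g y := by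
  obtain ⟨m, hm⟩ := exists_oscKernel_bound ha hM hb k q
  obtain ⟨C, hC⟩ := hm 0
  refine ((hg.integrable_pow_mul_norm hgc.aestronglyMeasurable m).const_mul C).mono'
    ((continuous_oscKernel ha hb.1.continuous k q x).mul hgc).aestronglyMeasurable
    (Filter.Eventually.of_forall fun y => ?_)
  rw [norm_mul, ← mul_assoc]
  gcongr
  simpa using hC x y

theorem rapidDecay_integral_oscKernel_mul (ha : Cutoff a R) (hM : 0 ≤ M)
    (hb : b.HasTemperateGrowth) (k : ℕ) (q : SchwartzMap ℝ ℂ) {g : ℝ → ℂ} (hg : RapidDecay g)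
    (hgc : Continuous g) : RapidDecay fun x => ∫ y, oscKernel a M b k q x y * g y := by
  intro n
  obtain ⟨m, hm⟩ := exists_oscKernel_bound ha hM hb k q
  obtain ⟨C, hC⟩ := hm n
  refine ⟨∫ y, C * ((1 + |y|) ^ (n + m) * ‖g y‖), fun x => ?_⟩
  have h0 : 0 ≤ (1 + |x|) ^ n := by positivity
  rw [← Real.norm_of_nonneg h0, ← Complex.norm_real, ← norm_mul, ← integral_const_mul]
  refine norm_integral_le_of_norm_le
    ((hg.integrable_pow_mul_norm hgc.aestronglyMeasurable _).const_mul C)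
    (Filter.Eventually.of_forall fun y => ?_)
  rw [norm_mul, norm_mul, Complex.norm_real, Real.norm_of_nonneg h0, ← mul_assoc, ← mul_assoc]
  exact mul_le_mul_of_nonneg_right (hC x y) (norm_nonneg _)

theorem norm_ofReal_mul_inv_sqrt_le (hM : 0 ≤ M) (x : ℝ) :
    ‖((M * (√(1 + x ^ 2))⁻¹ : ℝ) : ℂ)‖ ≤ M := by
  rw [Complex.norm_real, Real.norm_of_nonneg (by positivity)]
  refine mul_le_of_le_one_right hM (inv_le_one_of_one_le₀ ?_)
  exact Real.one_le_sqrt.2 (by nlinarith [sq_nonneg x])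

theorem hasDerivAt_integral_oscKernel_mul (ha : Cutoff a R) (hM : 0 ≤ M)
    (hb : b.HasTemperateGrowth) (k : ℕ) (q : SchwartzMap ℝ ℂ) {g : ℝ → ℂ} (hg : RapidDecay g)
    (hgc : Continuous g) (x : ℝ) : HasDerivAt (fun x => ∫ y, oscKernel a M b k q x y * g y)
      ((∫ y, oscKernel a M (deriv b) (k + 1) q x y * g y) +
        ((∫ y, oscKernel a M b k (tmul (fun ξ => Complex.I * ξ) q) x y * g y) +
          ((M * (√(1 + x ^ 2))⁻¹ : ℝ) : ℂ) *
            ∫ y, oscKernel a M b k (tmul (fun ξ => (a ξ : ℂ)) q) x y * g y)) x := by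
  have hgm := hgc.aestronglyMeasurable (μ := volume)
  set q₁ := tmul (fun ξ => Complex.I * ξ) q with hq₁
  set q₂ := tmul (fun ξ => (a ξ : ℂ)) q with hq₂
  obtain ⟨m₀, h₀⟩ := exists_oscKernel_bound ha hM hb.deriv (k + 1) q
  obtain ⟨m₁, h₁⟩ := exists_oscKernel_bound ha hM hb k q₁
  obtain ⟨m₂, h₂⟩ := exists_oscKernel_bound ha hM hb k q₂
  obtain ⟨C₀, hC₀⟩ := h₀ 0
  obtain ⟨C₁, hC₁⟩ := h₁ 0
  obtain ⟨C₂, hC₂⟩ := h₂ 0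
  simp only [pow_zero, one_mul, zero_add] at hC₀ hC₁ hC₂
  have i₀ := integrable_oscKernel_mul ha hM hb.deriv (k + 1) q hg hgc x
  have i₁ := integrable_oscKernel_mul ha hM hb k q₁ hg hgc x
  have i₂ := (integrable_oscKernel_mul ha hM hb k q₂ hg hgc x).const_mul
    ((M * (√(1 + x ^ 2))⁻¹ : ℝ) : ℂ)
  have e1 := integral_add i₀ (i₁.add i₂)
  have e2 := integral_add i₁ i₂
  simp only [Pi.add_apply] at e1
  rw [e2, integral_const_mul] at e1
  rw [← e1]
  have b₀ := (hg.integrable_pow_mul_norm hgm m₀).const_mul C₀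
  have b₁ := (hg.integrable_pow_mul_norm hgm m₁).const_mul C₁
  have b₂ := ((hg.integrable_pow_mul_norm hgm m₂).const_mul C₂).const_mul M
  refine (hasDerivAt_integral_of_dominated_loc_of_deriv_le
    (F := fun x y => oscKernel a M b k q x y * g y)
    (F' := fun x y => oscKernel a M (deriv b) (k + 1) q x y * g y +
      (oscKernel a M b k q₁ x y * g y + ((M * (√(1 + x ^ 2))⁻¹ : ℝ) : ℂ) *
          (oscKernel a M b k q₂ x y * g y)))
    (bound := fun y => C₀ * ((1 + |y|) ^ m₀ * ‖g y‖) + (C₁ * ((1 + |y|) ^ m₁ * ‖g y‖) +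
      M * (C₂ * ((1 + |y|) ^ m₂ * ‖g y‖))))
    Filter.univ_mem
    (Filter.Eventually.of_forall fun x =>
      ((continuous_oscKernel ha hb.1.continuous k q x).mul hgc).aestronglyMeasurable)
    (integrable_oscKernel_mul ha hM hb k q hg hgc x)
    (i₀.add (i₁.add i₂)).aestronglyMeasurable
    (Filter.Eventually.of_forall fun y x' _ => ?_)
    (b₀.add (b₁.add b₂))
    (Filter.Eventually.of_forall fun y x' _ => ?_)).2
  · have hM' := norm_ofReal_mul_inv_sqrt_le hM x'
    refine (norm_add_le _ _).trans (add_le_add ?_ ((norm_add_le _ _).trans (add_le_add ?_ ?_)))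
    · rw [norm_mul, ← mul_assoc]
      exact mul_le_mul_of_nonneg_right (hC₀ x' y) (norm_nonneg _)
    · rw [norm_mul, ← mul_assoc]
      exact mul_le_mul_of_nonneg_right (hC₁ x' y) (norm_nonneg _)
    · rw [norm_mul, norm_mul, ← mul_assoc C₂]
      exact mul_le_mul hM' (mul_le_mul_of_nonneg_right (hC₂ x' y) (norm_nonneg _))
        (by positivity) hM
  · convert! (hasDerivAt_oscKernel (M := M) ha hb k q x' y).mul_const (g y) using 1
    ring

/-- Integral operators with kernel `oscKernel` map continuous rapidly decaying functions to
Schwartz functions. -/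
theorem exists_schwartzMap_oscKernel (ha : Cutoff a R) (hM : 0 ≤ M) (hb : b.HasTemperateGrowth)
    (k : ℕ) (q : SchwartzMap ℝ ℂ) {g : ℝ → ℂ} (hg : RapidDecay g) (hgc : Continuous g) :
    ∃ p : SchwartzMap ℝ ℂ, ∀ x, p x = ∫ y, oscKernel a M b k q x y * g y := by
  set G := fun (i : {b : ℝ → ℂ // b.HasTemperateGrowth} × ℕ × SchwartzMap ℝ ℂ) (x : ℝ) =>
    ∫ y, oscKernel a M i.1.1 i.2.1 i.2.2 x y * g y with hG
  have base (b : ℝ → ℂ) (hb : b.HasTemperateGrowth) (k : ℕ) (q : SchwartzMap ℝ ℂ) :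
      TemperateSpan G fun x => ∫ y, oscKernel a M b k q x y * g y :=
    TemperateSpan.base (G := G) (⟨b, hb⟩, k, q)
  have hder (i) : ∃ f', TemperateSpan G f' ∧ ∀ x, HasDerivAt (G i) (f' x) x := by
    obtain ⟨⟨b, hb⟩, k, q⟩ := i
    have h := hasDerivAt_integral_oscKernel_mul ha hM hb k q hg hgc
    simp only [Complex.ofReal_mul, ← deriv_ofReal_arsinh] at h
    exact ⟨_, (base _ hb.deriv (k + 1) q).add ((base _ hb k _).add
      ((base _ hb k _).mul ((Function.HasTemperateGrowth.const (M : ℂ)).mul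
        arsinh_hasTemperateGrowth.deriv))), h⟩
  refine TemperateSpan.exists_schwartzMap (fun i => ?_) hder (base b hb k q)
  exact rapidDecay_integral_oscKernel_mul ha hM i.1.2 i.2.1 i.2.2 hg hgc

end

theorem tendsto_integral_cexp_cocompact (F : ℝ → ℂ) (x : ℝ) :
    Filter.Tendsto (fun ξ : ℝ => ∫ y : ℝ, Complex.exp (Complex.I * ((x - y : ℝ) : ℂ) * ξ) * F y)
      (Filter.cocompact ℝ) (nhds 0) := by
  have hpi : 0 < 2 * Real.pi := by positivity
  have h := (Real.tendsto_integral_exp_smul_cocompact F).comp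
    (Filter.tendsto_cocompact_mul_left₀ (a := (2 * Real.pi)⁻¹) (by positivity))
  rw [tendsto_zero_iff_norm_tendsto_zero] at h ⊢
  refine h.congr fun ξ => ?_
  have e : ∀ y : ℝ, Complex.exp (Complex.I * ((x - y : ℝ) : ℂ) * ξ) * F y =
      Complex.exp (Complex.I * x * ξ) *
        (Real.fourierChar (-(y * ((2 * Real.pi)⁻¹ * ξ))) • F y) := fun y => by
    rw [Circle.smul_def, Real.fourierChar_apply, smul_eq_mul, ← mul_assoc, ← Complex.exp_add]
    congr 2
    have : (Real.pi : ℂ) ≠ 0 := by exact_mod_cast Real.pi_ne_zero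
    push_cast
    field_simp
    ring
  simp only [e]
  rw [integral_const_mul, norm_mul, norm_cexp_I_mul, one_mul]
  rfl

theorem integrable_exp_mul_arsinh_sub (M x : ℝ) (g : SchwartzMap ℝ ℂ) :
    Integrable fun y => Real.exp (M * |Real.arsinh x - Real.arsinh y|) * ‖g y‖ := by
  have hc := Real.continuous_arsinh
  have hg := g.continuous
  refine ((g.rapidDecay.integrable_pow_mul_norm g.continuous.aestronglyMeasurable
    (2 * ⌈M⌉₊)).const_mul ((1 + |x|) ^ (2 * ⌈M⌉₊))).mono'
    (Continuous.aestronglyMeasurable (by fun_prop)) (Filter.Eventually.of_forall fun y => ?_)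
  rw [Real.norm_of_nonneg (by positivity), ← mul_assoc, ← mul_pow]
  refine mul_le_mul_of_nonneg_right ((exp_mul_abs_arsinh_sub_le M x y).trans ?_) (norm_nonneg _)
  gcongr
  nlinarith [abs_sub x y, abs_nonneg x, abs_nonneg y]

theorem abs_arsinh_sub_le (x y : ℝ) : |Real.arsinh x - Real.arsinh y| ≤ |x - y| := by
  have h := Convex.norm_image_sub_le_of_norm_deriv_le (f := Real.arsinh) (C := 1) (s := Set.univ)
    (x := y) (y := x) (fun x _ => Real.differentiable_arsinh x) (fun x _ => by
      rw [(Real.hasDerivAt_arsinh x).deriv, Real.norm_of_nonneg (by positivity)]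
      exact inv_le_one_of_one_le₀ (Real.one_le_sqrt.2 (by nlinarith [sq_nonneg x])))
    convex_univ trivial trivial
  simpa using h

theorem segAvg_deriv_arsinh {x y : ℝ} (h : y ≠ x) :
    segAvg (deriv fun x => (Real.arsinh x : ℂ)) 0 x y =
      (((Real.arsinh x - Real.arsinh y) / (x - y) : ℝ) : ℂ) := by
  have hz : ((x - y : ℝ) : ℂ) ≠ 0 := by exact_mod_cast sub_ne_zero.2 h.symm
  have hd : ∀ t : ℝ, HasDerivAt (fun t : ℝ => (Real.arsinh (y + t * (x - y)) : ℂ))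
      (((x - y : ℝ) : ℂ) * deriv (fun x => (Real.arsinh x : ℂ)) (y + t * (x - y))) t := fun t => by
    have h1 : HasDerivAt (fun t : ℝ => y + t * (x - y)) (x - y) t := by
      simpa using ((hasDerivAt_id t).mul_const (x - y)).const_add y
    have h2 := (Real.hasDerivAt_arsinh (y + t * (x - y))).ofReal_comp
    have h3 := h2.scomp t h1
    rw [deriv_ofReal_arsinh]
    exact h3
  have hc : Continuous (deriv fun x => (Real.arsinh x : ℂ)) :=
    arsinh_hasTemperateGrowth.deriv.1.continuous
  have h1 := intervalIntegral.integral_eq_sub_of_hasDerivAt (a := 0) (b := 1)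
    (fun t _ => hd t) (Continuous.intervalIntegrable (by fun_prop) _ _)
  rw [intervalIntegral.integral_const_mul] at h1
  unfold segAvg
  simp only [pow_zero, one_mul]
  rw [Complex.ofReal_div, eq_div_iff hz, mul_comm, h1]
  push_cast
  simp

theorem norm_segAvg_deriv_arsinh_le (x y : ℝ) :
    ‖segAvg (deriv fun x => (Real.arsinh x : ℂ)) 0 x y‖ ≤ 1 := by
  refine norm_segAvg_le 0 fun t _ _ => ?_
  rw [deriv_ofReal_arsinh]
  simpa using norm_ofReal_mul_inv_sqrt_le zero_le_one (y + t * (x - y))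

section

variable {a : ℝ → ℝ} {R M : ℝ}

theorem abs_mul_cutoff_mul_le (ha : Cutoff a R) (hM : 0 ≤ M) (ξ d : ℝ) :
    |M * a ξ * d| ≤ M * |d| := by
  rw [abs_mul, abs_mul, abs_of_nonneg hM]
  exact mul_le_mul_of_nonneg_right (mul_le_of_le_one_right hM (ha.abs_le_one ξ)) (abs_nonneg d)

/-- The function of frequency whose derivative relates the composition of the operator with its
approximate inverse to the identity. -/
def auxPrimitive (a : ℝ → ℝ) (M : ℝ) (g : ℝ → ℂ) (x ξ : ℝ) : ℂ :=
  ∫ y : ℝ, Complex.exp (Complex.I * ((x - y : ℝ) : ℂ) * ξ) *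
    (((Real.exp (M * a ξ * (Real.arsinh x - Real.arsinh y)) - 1 : ℝ) : ℂ) /
      (Complex.I * ((x - y : ℝ) : ℂ)) * g y)

theorem norm_auxPrimitive_factor_le (ha : Cutoff a R) (hM : 0 ≤ M) (x ξ y : ℝ) :
    ‖((Real.exp (M * a ξ * (Real.arsinh x - Real.arsinh y)) - 1 : ℝ) : ℂ) /
      (Complex.I * ((x - y : ℝ) : ℂ))‖ ≤
        M * Real.exp (M * |Real.arsinh x - Real.arsinh y|) := by
  set d := Real.arsinh x - Real.arsinh y with hd
  rw [norm_div, norm_mul, Complex.norm_I, one_mul, Complex.norm_real, Complex.norm_real]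
  refine div_le_of_le_mul₀ (norm_nonneg _) (by positivity) ?_
  have h := Complex.norm_exp_sub_one_le_mul_exp_abs_re ((M * a ξ * d : ℝ) : ℂ)
  rw [Complex.ofReal_re, ← Complex.ofReal_exp, ← Complex.ofReal_one, ← Complex.ofReal_sub,
    Complex.norm_real, Complex.norm_real, Real.norm_eq_abs (M * a ξ * d)] at h
  have h1 := abs_mul_cutoff_mul_le ha hM ξ d
  have h2 := abs_arsinh_sub_le x y
  calc _ ≤ _ := h
    _ ≤ Real.exp (M * |d|) * (M * |x - y|) := by
      gcongr
      exact h1.trans (by gcongr)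
    _ = _ := by rw [Real.norm_eq_abs]; ring

theorem measurable_auxPrimitive_factor (x c : ℝ) : Measurable fun y : ℝ =>
    ((Real.exp (c * (Real.arsinh x - Real.arsinh y)) - 1 : ℝ) : ℂ) /
      (Complex.I * ((x - y : ℝ) : ℂ)) := by
  have := Real.continuous_arsinh
  exact Measurable.div (Continuous.measurable (by fun_prop)) (Continuous.measurable (by fun_prop))

theorem integrable_auxPrimitive (ha : Cutoff a R) (hM : 0 ≤ M) (g : SchwartzMap ℝ ℂ) (x ξ : ℝ) :
    Integrable fun y : ℝ => Complex.exp (Complex.I * ((x - y : ℝ) : ℂ) * ξ) *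
    (((Real.exp (M * a ξ * (Real.arsinh x - Real.arsinh y)) - 1 : ℝ) : ℂ) /
      (Complex.I * ((x - y : ℝ) : ℂ)) * g y) := by
  refine ((integrable_exp_mul_arsinh_sub M x g).const_mul M).mono'
    (Measurable.aestronglyMeasurable ?_) (Filter.Eventually.of_forall fun y => ?_)
  · exact (Continuous.measurable (by fun_prop)).mul
      ((measurable_auxPrimitive_factor x (M * a ξ)).mul g.continuous.measurable)
  · rw [norm_mul, norm_cexp_I_mul, one_mul, norm_mul, ← mul_assoc]
    gcongr
    exact norm_auxPrimitive_factor_le ha hM x ξ y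

theorem tendsto_auxPrimitive (ha : Cutoff a R) (g : ℝ → ℂ) (x : ℝ) :
    Filter.Tendsto (auxPrimitive a M g x) Filter.atTop (nhds 0) ∧
    Filter.Tendsto (auxPrimitive a M g x) Filter.atBot (nhds 0) := by
  have h (c : ℝ) := tendsto_integral_cexp_cocompact (fun y =>
    (((Real.exp (M * c * (Real.arsinh x - Real.arsinh y)) - 1 : ℝ) : ℂ) /
      (Complex.I * ((x - y : ℝ) : ℂ)) * g y)) x
  constructor
  · refine ((h (a R)).mono_left _root_.atTop_le_cocompact).congr' ?_
    filter_upwards [Filter.eventually_ge_atTop R] with ξ hξ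
    rw [auxPrimitive, ha.eq_of_ge ξ R hξ le_rfl]
  · refine ((h (a (-R))).mono_left _root_.atBot_le_cocompact).congr' ?_
    filter_upwards [Filter.eventually_le_atBot (-R)] with ξ hξ
    rw [auxPrimitive, ha.eq_of_le ξ (-R) hξ le_rfl]

end

/-- The derivative of `arsinh`, with complex values. -/
abbrev arsinhDeriv : ℝ → ℂ := deriv fun x => (Real.arsinh x : ℂ)

theorem continuous_arsinhDeriv : Continuous arsinhDeriv :=
  arsinh_hasTemperateGrowth.deriv.1.continuous

section

variable {a : ℝ → ℝ} {R M : ℝ}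

theorem norm_oscIntegrand_le (ha : Cutoff a R) (hM : 0 ≤ M) (g : ℝ → ℂ) (x ξ y : ℝ) :
    ‖Complex.exp (Complex.I * ((x - y : ℝ) : ℂ) * ξ) *
      (((Real.exp (M * a ξ * (Real.arsinh x - Real.arsinh y)) : ℝ) : ℂ) * g y)‖ ≤
      Real.exp (M * |Real.arsinh x - Real.arsinh y|) * ‖g y‖ := by
  rw [norm_mul, norm_cexp_I_mul, one_mul, norm_mul, Complex.norm_real,
    Real.norm_of_nonneg (Real.exp_pos _).le]
  exact mul_le_mul_of_nonneg_right (Real.exp_le_exp.2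
    ((le_abs_self _).trans (abs_mul_cutoff_mul_le ha hM _ _))) (norm_nonneg _)

theorem integrable_oscIntegrand (ha : Cutoff a R) (hM : 0 ≤ M) (g : SchwartzMap ℝ ℂ) (x ξ : ℝ) :
    Integrable fun y : ℝ => Complex.exp (Complex.I * ((x - y : ℝ) : ℂ) * ξ) *
      (((Real.exp (M * a ξ * (Real.arsinh x - Real.arsinh y)) : ℝ) : ℂ) * g y) := by
  have := Real.continuous_arsinh
  have := g.continuous
  exact (integrable_exp_mul_arsinh_sub M x g).mono' (Continuous.aestronglyMeasurable (by fun_prop))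
    (Filter.Eventually.of_forall (norm_oscIntegrand_le ha hM g x ξ))

theorem integrable_cexp_mul (g : SchwartzMap ℝ ℂ) (x ξ : ℝ) :
    Integrable fun y : ℝ => Complex.exp (Complex.I * ((x - y : ℝ) : ℂ) * ξ) * g y := by
  have := g.continuous
  refine g.integrable.norm.mono' (Continuous.aestronglyMeasurable (by fun_prop))
    (Filter.Eventually.of_forall fun y => ?_)
  rw [norm_mul, norm_cexp_I_mul, one_mul]

theorem integral_oscIntegrand (g : ℝ → ℂ) (x ξ : ℝ) :
    ∫ y : ℝ, Complex.exp (Complex.I * ((x - y : ℝ) : ℂ) * ξ) *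
      (((Real.exp (M * a ξ * (Real.arsinh x - Real.arsinh y)) : ℝ) : ℂ) * g y) =
    Complex.exp (Complex.I * x * ξ) * ((Real.exp (M * Real.arsinh x * a ξ) : ℝ) : ℂ) *
      osc Real.arsinh g (-ξ) (-M * a ξ) := by
  unfold osc
  rw [← integral_const_mul]
  congr 1; ext y
  rw [show M * a ξ * (Real.arsinh x - Real.arsinh y) =
    M * Real.arsinh x * a ξ + -M * a ξ * Real.arsinh y by ring, Real.exp_add,
    show Complex.I * ((x - y : ℝ) : ℂ) * ξ =
      Complex.I * x * ξ + Complex.I * ((-ξ : ℝ) : ℂ) * y by push_cast; ring, Complex.exp_add]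
  push_cast
  ring

theorem integral_cexp_mul (g : ℝ → ℂ) (x ξ : ℝ) :
    ∫ y : ℝ, Complex.exp (Complex.I * ((x - y : ℝ) : ℂ) * ξ) * g y =
      Complex.exp (Complex.I * x * ξ) * hat g ξ := by
  unfold hat
  rw [← integral_const_mul]
  congr 1; ext y
  rw [show Complex.I * ((x - y : ℝ) : ℂ) * ξ =
      Complex.I * x * ξ + -Complex.I * y * ξ by push_cast; ring, Complex.exp_add]
  ring

theorem norm_segAvg_mul_oscIntegrand_le (ha : Cutoff a R) (hM : 0 ≤ M) (g : ℝ → ℂ) (x ξ y : ℝ) :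
    ‖segAvg arsinhDeriv 0 x y * (Complex.exp (Complex.I * ((x - y : ℝ) : ℂ) * ξ) *
      (((Real.exp (M * a ξ * (Real.arsinh x - Real.arsinh y)) : ℝ) : ℂ) * g y))‖ ≤
      Real.exp (M * |Real.arsinh x - Real.arsinh y|) * ‖g y‖ := by
  rw [norm_mul]
  exact (mul_le_of_le_one_left (norm_nonneg _) (norm_segAvg_deriv_arsinh_le x y)).trans
    (norm_oscIntegrand_le ha hM g x ξ y)

theorem integrable_segAvg_mul_oscIntegrand (ha : Cutoff a R) (hM : 0 ≤ M) (g : SchwartzMap ℝ ℂ)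
    (x ξ : ℝ) : Integrable fun y : ℝ =>
      segAvg arsinhDeriv 0 x y * (Complex.exp (Complex.I * ((x - y : ℝ) : ℂ) * ξ) *
      (((Real.exp (M * a ξ * (Real.arsinh x - Real.arsinh y)) : ℝ) : ℂ) * g y)) := by
  have := Real.continuous_arsinh
  have := g.continuous
  have h1 : Continuous (segAvg arsinhDeriv 0 x) :=
    (continuous_segAvg continuous_arsinhDeriv 0).comp (f := fun y => (x, y)) (by fun_prop)
  exact (integrable_exp_mul_arsinh_sub M x g).mono' (Continuous.aestronglyMeasurable (by fun_prop))
    (Filter.Eventually.of_forall (norm_segAvg_mul_oscIntegrand_le ha hM g x ξ))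

theorem integrable_uncurry_segAvg_mul (ha : Cutoff a R) (hM : 0 ≤ M) (g : SchwartzMap ℝ ℂ)
    (x : ℝ) : Integrable (Function.uncurry fun ξ y : ℝ => ha.derivSchwartz ξ *
      (segAvg arsinhDeriv 0 x y * (Complex.exp (Complex.I * ((x - y : ℝ) : ℂ) * ξ) *
      (((Real.exp (M * a ξ * (Real.arsinh x - Real.arsinh y)) : ℝ) : ℂ) * g y))))
      (volume.prod volume) := by
  have := Real.continuous_arsinh
  have := g.continuous
  have := ha.derivSchwartz.continuous
  have := ha.continuous
  have h1 : Continuous (segAvg arsinhDeriv 0 x) :=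
    (continuous_segAvg continuous_arsinhDeriv 0).comp (f := fun y => (x, y)) (by fun_prop)
  refine ((ha.derivSchwartz.integrable.norm).mul_prod (integrable_exp_mul_arsinh_sub M x g)).mono'
    (Continuous.aestronglyMeasurable (by unfold Function.uncurry; fun_prop))
    (Filter.Eventually.of_forall fun p => ?_)
  obtain ⟨ξ, y⟩ := p
  simp only [Function.uncurry]
  rw [norm_mul]
  exact mul_le_mul_of_nonneg_left (norm_segAvg_mul_oscIntegrand_le ha hM g x ξ y) (norm_nonneg _)

theorem integral_derivSchwartz_mul (ha : Cutoff a R) (hM : 0 ≤ M) (g : SchwartzMap ℝ ℂ) (x : ℝ) :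
    ∫ ξ, ha.derivSchwartz ξ * ∫ y : ℝ,
      segAvg arsinhDeriv 0 x y * (Complex.exp (Complex.I * ((x - y : ℝ) : ℂ) * ξ) *
      (((Real.exp (M * a ξ * (Real.arsinh x - Real.arsinh y)) : ℝ) : ℂ) * g y)) =
    ∫ y, oscKernel a M arsinhDeriv 0 ha.derivSchwartz x y * g y := by
  simp_rw [← integral_const_mul]
  rw [integral_integral_swap (integrable_uncurry_segAvg_mul ha hM g x)]
  congr 1; ext y
  rw [oscKernel, osc, mul_right_comm, mul_comm, ← integral_const_mul]
  congr 1; ext ξ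
  rw [show M * a ξ * (Real.arsinh x - Real.arsinh y) =
    M * (Real.arsinh x - Real.arsinh y) * a ξ by ring]
  ring

theorem hasDerivAt_auxPrimitive (ha : Cutoff a R) (hM : 0 ≤ M) (g : SchwartzMap ℝ ℂ) (x ξ : ℝ) :
    HasDerivAt (auxPrimitive a M g x)
      ((Complex.exp (Complex.I * x * ξ) * ((Real.exp (M * Real.arsinh x * a ξ) : ℝ) : ℂ) *
        osc Real.arsinh g (-ξ) (-M * a ξ) - Complex.exp (Complex.I * x * ξ) * hat g ξ) +
        (-Complex.I * M) * (ha.derivSchwartz ξ * ∫ y : ℝ,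
          segAvg arsinhDeriv 0 x y * (Complex.exp (Complex.I * ((x - y : ℝ) : ℂ) * ξ) *
      (((Real.exp (M * a ξ * (Real.arsinh x - Real.arsinh y)) : ℝ) : ℂ) * g y)))) ξ := by
  have i₀ := integrable_oscIntegrand ha hM g x ξ
  have i₁ := integrable_cexp_mul g x ξ
  have i₂ := ((integrable_segAvg_mul_oscIntegrand ha hM g x ξ).const_mul
    (ha.derivSchwartz ξ)).const_mul (-Complex.I * M)
  have e1 := integral_add (i₀.sub i₁) i₂
  simp only [Pi.sub_apply] at e1
  rw [integral_sub i₀ i₁, integral_const_mul, integral_const_mul, integral_oscIntegrand,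
    integral_cexp_mul] at e1
  rw [← e1]
  obtain ⟨A, hA⟩ : ∃ A, ∀ ξ, ‖ha.derivSchwartz ξ‖ ≤ A := by
    obtain ⟨A, hA⟩ := ha.derivSchwartz.rapidDecay 0
    exact ⟨A, by simpa using hA⟩
  have b₀ := integrable_exp_mul_arsinh_sub M x g
  refine (hasDerivAt_integral_of_dominated_loc_of_deriv_le
    (F := fun ξ y : ℝ => Complex.exp (Complex.I * ((x - y : ℝ) : ℂ) * ξ) *
      (((Real.exp (M * a ξ * (Real.arsinh x - Real.arsinh y)) - 1 : ℝ) : ℂ) /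
      (Complex.I * ((x - y : ℝ) : ℂ)) * g y))
    (F' := fun ξ y : ℝ => (Complex.exp (Complex.I * ((x - y : ℝ) : ℂ) * ξ) *
      (((Real.exp (M * a ξ * (Real.arsinh x - Real.arsinh y)) : ℝ) : ℂ) * g y) -
      Complex.exp (Complex.I * ((x - y : ℝ) : ℂ) * ξ) * g y) +
      (-Complex.I * M) * (ha.derivSchwartz ξ *
      (segAvg arsinhDeriv 0 x y * (Complex.exp (Complex.I * ((x - y : ℝ) : ℂ) * ξ) *
      (((Real.exp (M * a ξ * (Real.arsinh x - Real.arsinh y)) : ℝ) : ℂ) * g y)))))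
    (bound := fun y => (Real.exp (M * |Real.arsinh x - Real.arsinh y|) * ‖g y‖ + ‖g y‖) +
      M * (A * (Real.exp (M * |Real.arsinh x - Real.arsinh y|) * ‖g y‖)))
    Filter.univ_mem
    (Filter.Eventually.of_forall fun ξ =>
      (integrable_auxPrimitive ha hM g x ξ).aestronglyMeasurable)
    (integrable_auxPrimitive ha hM g x ξ)
    ((i₀.sub i₁).add i₂).aestronglyMeasurable
    (Filter.Eventually.of_forall fun y ξ' _ => ?_)
    ((b₀.add g.integrable.norm).add ((b₀.const_mul A).const_mul M)) ?_).2
  · refine (norm_add_le _ _).trans (add_le_add ((norm_sub_le _ _).trans (add_le_add ?_ ?_)) ?_)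
    · exact norm_oscIntegrand_le ha hM g x ξ' y
    · rw [norm_mul, norm_cexp_I_mul, one_mul]
    · rw [norm_mul, norm_mul (ha.derivSchwartz ξ')]
      have hMn : ‖(-Complex.I * M : ℂ)‖ = M := by simp [abs_of_nonneg hM]
      rw [hMn]
      have hA0 := (norm_nonneg _).trans (hA 0)
      exact mul_le_mul_of_nonneg_left (mul_le_mul (hA ξ')
        (norm_segAvg_mul_oscIntegrand_le ha hM g x ξ' y) (norm_nonneg _) hA0) hM
  · filter_upwards [compl_mem_ae_iff.2 (measure_singleton x)] with y hy ξ' _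
    have hy : y ≠ x := hy
    have hz : ((x - y : ℝ) : ℂ) ≠ 0 := by exact_mod_cast sub_ne_zero.2 hy.symm
    rw [segAvg_deriv_arsinh hy]
    have h1 : HasDerivAt (fun ξ : ℝ => Complex.exp (Complex.I * ((x - y : ℝ) : ℂ) * (ξ : ℂ)))
        (Complex.exp (Complex.I * ((x - y : ℝ) : ℂ) * (ξ' : ℂ)) *
          (Complex.I * ((x - y : ℝ) : ℂ) * 1)) ξ' :=
      ((Complex.ofRealCLM.hasDerivAt (x := ξ')).const_mul (Complex.I * ((x - y : ℝ) : ℂ))).cexp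
    have h2 := (((((ha.differentiable ξ').hasDerivAt.const_mul M).mul_const
      (Real.arsinh x - Real.arsinh y)).exp.sub_const 1).ofReal_comp.div_const
      (Complex.I * ((x - y : ℝ) : ℂ))).mul_const (g y)
    convert! h1.mul h2 using 1
    rw [ha.derivSchwartz_apply]
    generalize Complex.exp (Complex.I * ((x - y : ℝ) : ℂ) * (ξ' : ℂ)) = E
    generalize Real.exp (M * a ξ' * (Real.arsinh x - Real.arsinh y)) = e
    generalize x - y = z at *
    have hI := Complex.I_ne_zero
    push_cast
    field_simp
    ring_nf
    simp only [Complex.I_sq]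
    ring

/-- Composition of the operator with its approximate inverse. -/
theorem osc_comp_osc_eq (ha : Cutoff a R) (hM : 0 ≤ M) (g v : SchwartzMap ℝ ℂ)
    (hv : ∀ ξ, v ξ = osc Real.arsinh g (-ξ) (-M * a ξ)) (x : ℝ) :
    osc a v x (M * Real.arsinh x) = 2 * Real.pi * g x +
      Complex.I * M * ∫ y, oscKernel a M arsinhDeriv 0 ha.derivSchwartz x y * g y := by
  have i₀ := ha.oscAdmissible.integrable v x (d := M * Real.arsinh x) trivial
  have i₁ : Integrable fun ξ : ℝ => Complex.exp (Complex.I * x * ξ) * hat g ξ := by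
    rw [← coe_hatS]
    have := (hatS g).continuous
    refine (hatS g).integrable.norm.mono' (Continuous.aestronglyMeasurable (by fun_prop))
      (Filter.Eventually.of_forall fun y => ?_)
    rw [norm_mul, norm_cexp_I_mul, one_mul]
  have i₂ := (integrable_uncurry_segAvg_mul ha hM g x).integral_prod_left
  simp only [Function.uncurry, integral_const_mul] at i₂
  have i₃ := i₂.const_mul (-Complex.I * M)
  have hd := hasDerivAt_auxPrimitive ha hM g x
  simp only [← hv] at hd
  have h := integral_of_hasDerivAt_of_tendsto hd ((i₀.sub i₁).add i₃)
    (tendsto_auxPrimitive ha g x).2 (tendsto_auxPrimitive ha g x).1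
  have e1 := integral_add (i₀.sub i₁) i₃
  simp only [Pi.sub_apply] at e1
  rw [integral_sub i₀ i₁, integral_const_mul, hat_inversion,
    integral_derivSchwartz_mul ha hM] at e1
  rw [h] at e1
  unfold osc
  linear_combination -e1

end

/-- An integrable function of total mass `2`. -/
def decayTwo (z : ℝ) : ℝ := ((1 + |z|) ^ 2)⁻¹

theorem decayTwo_nonneg (z : ℝ) : 0 ≤ decayTwo z := by unfold decayTwo; positivity

theorem integrable_decayTwo : Integrable decayTwo := by
  have h := integrable_one_add_norm (E := ℝ) (μ := volume) (r := 2) (by norm_num)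
  refine h.congr (Filter.Eventually.of_forall fun z => ?_)
  simp only [decayTwo, Real.norm_eq_abs]
  rw [Real.rpow_neg (by positivity)]
  norm_cast

theorem one_add_mul_pow_le {ε z : ℝ} (h0 : 0 ≤ ε) (h1 : ε ≤ 1) (hz : 0 ≤ z) (n : ℕ) :
    (1 + ε * z) ^ n ≤ 1 + ε * (1 + z) ^ n := by
  have h := (convexOn_pow (𝕜 := ℝ) n).2 (Set.mem_Ici.2 zero_le_one)
    (Set.mem_Ici.2 (by linarith : 0 ≤ 1 + z)) (by linarith : 0 ≤ 1 - ε) h0 (by ring)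
  simp only [smul_eq_mul, one_pow, mul_one] at h
  rw [show 1 - ε + ε * (1 + z) = 1 + ε * z by ring] at h
  linarith

theorem weighted_kernel_le {r : ℝ → ℝ → ℂ} {K : ℝ → ℝ} (hK : ∀ x y, ‖r x y‖ ≤ K (x - y)) {n : ℕ}
    {C ε : ℝ} (hC : ∀ x y, (1 + |x - y|) ^ (n + 2) * ‖r x y‖ ≤ C) (h0 : 0 ≤ ε) (h1 : ε ≤ 1)
    (x y : ℝ) : (1 + ε * |x|) ^ n * ‖r x y‖ ≤
      (1 + ε * |y|) ^ n * (K (x - y) + ε * C * decayTwo (x - y)) := by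
  have hx : 1 + ε * |x| ≤ (1 + ε * |y|) * (1 + ε * |x - y|) := by
    have h : |x| ≤ |y| + |x - y| := by simpa using abs_add_le y (x - y)
    have : 0 ≤ (ε * |y|) * (ε * |x - y|) := by positivity
    nlinarith
  have hd : (1 + |x - y|) ^ n * ‖r x y‖ ≤ C * decayTwo (x - y) := by
    rw [decayTwo, ← div_eq_mul_inv, le_div_iff₀ (by positivity)]
    refine le_of_eq_of_le ?_ (hC x y)
    ring
  calc (1 + ε * |x|) ^ n * ‖r x y‖
      ≤ ((1 + ε * |y|) * (1 + ε * |x - y|)) ^ n * ‖r x y‖ := by gcongr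
    _ = (1 + ε * |y|) ^ n * ((1 + ε * |x - y|) ^ n * ‖r x y‖) := by rw [mul_pow]; ring
    _ ≤ (1 + ε * |y|) ^ n * ((1 + ε * (1 + |x - y|) ^ n) * ‖r x y‖) := by
        have := one_add_mul_pow_le h0 h1 (abs_nonneg (x - y)) n
        gcongr
    _ = (1 + ε * |y|) ^ n * (‖r x y‖ + ε * ((1 + |x - y|) ^ n * ‖r x y‖)) := by ring
    _ ≤ (1 + ε * |y|) ^ n * (K (x - y) + ε * (C * decayTwo (x - y))) := by
        have := hK x y
        gcongr
    _ = _ := by ring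

/-- Weighted supremum bounds are contracted by an integral operator with small kernel. -/
theorem weighted_integral_le {r : ℝ → ℝ → ℂ} {K : ℝ → ℝ} (hKi : Integrable K)
    (hK : ∀ x y, ‖r x y‖ ≤ K (x - y)) {n : ℕ}
    {C ε A : ℝ} (hC : ∀ x y, (1 + |x - y|) ^ (n + 2) * ‖r x y‖ ≤ C) (h0 : 0 ≤ ε) (h1 : ε ≤ 1)
    {g : ℝ → ℂ} (hg : ∀ y, (1 + ε * |y|) ^ n * ‖g y‖ ≤ A) (x : ℝ) :
    (1 + ε * |x|) ^ n * ‖∫ y, r x y * g y‖ ≤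
      ((∫ z, K z) + ε * C * ∫ z, decayTwo z) * A := by
  have hw : 0 ≤ (1 + ε * |x|) ^ n := by positivity
  have hi : Integrable fun y => K (x - y) + ε * C * decayTwo (x - y) :=
    (hKi.comp_sub_left x).add ((integrable_decayTwo.comp_sub_left x).const_mul _)
  have hC0 : 0 ≤ C := le_trans (by positivity) (hC 0 0)
  have e : ((∫ z, K z) + ε * C * ∫ z, decayTwo z) * A =
      ∫ y, (K (x - y) + ε * C * decayTwo (x - y)) * A := by
    rw [integral_mul_const, integral_add (hKi.comp_sub_left x)
      ((integrable_decayTwo.comp_sub_left x).const_mul _), integral_const_mul,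
      integral_sub_left_eq_self K, integral_sub_left_eq_self decayTwo]
  rw [e, ← Real.norm_of_nonneg hw, ← Complex.norm_real, ← norm_mul, ← integral_const_mul]
  refine norm_integral_le_of_norm_le (hi.mul_const A) (Filter.Eventually.of_forall fun y => ?_)
  have hk := weighted_kernel_le hK hC h0 h1 x y
  have hp : 0 ≤ K (x - y) + ε * C * decayTwo (x - y) := by
    have := (norm_nonneg _).trans (hK x y)
    have := decayTwo_nonneg (x - y)
    positivity
  rw [norm_mul, norm_mul, Complex.norm_real, Real.norm_of_nonneg hw, ← mul_assoc]
  calc _ ≤ (1 + ε * |y|) ^ n * (K (x - y) + ε * C * decayTwo (x - y)) * ‖g y‖ := by gcongr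
    _ = (K (x - y) + ε * C * decayTwo (x - y)) * ((1 + ε * |y|) ^ n * ‖g y‖) := by ring
    _ ≤ _ := by gcongr; exact hg y

/-- Solvability of an integral equation of the second kind in the Schwartz space. -/
theorem exists_schwartzMap_add_integral_eq {r : ℝ → ℝ → ℂ} {K : ℝ → ℝ} (hKi : Integrable K)
    (hK : ∀ x y, ‖r x y‖ ≤ K (x - y)) (hK1 : ∫ z, K z < 1)
    (hr : ∀ n : ℕ, ∃ C, ∀ x y, (1 + |x - y|) ^ n * ‖r x y‖ ≤ C)
    (hrc : ∀ x, Continuous (r x))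
    (hT : ∀ g : ℝ → ℂ, RapidDecay g → Continuous g →
      ∃ p : SchwartzMap ℝ ℂ, ∀ x, p x = ∫ y, r x y * g y) (f : SchwartzMap ℝ ℂ) :
    ∃ g : SchwartzMap ℝ ℂ, ∀ x, g x + ∫ y, r x y * g y = f x := by
  choose T hTs using fun g : SchwartzMap ℝ ℂ => hT g g.rapidDecay g.continuous
  let s : ℕ → SchwartzMap ℝ ℂ := fun n => (fun g => -T g)^[n] f
  have hs0 : s 0 = f := rfl
  have hss : ∀ n x, s (n + 1) x = -∫ y, r x y * s n y := fun n x => by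
    rw [← hTs]
    simp only [s, Function.iterate_succ_apply']
    rfl
  have key : ∀ n : ℕ, ∃ ε q A : ℝ, 0 < ε ∧ ε ≤ 1 ∧ 0 ≤ q ∧ q < 1 ∧
      ∀ k x, (1 + ε * |x|) ^ n * ‖s k x‖ ≤ q ^ k * A := by
    intro n
    obtain ⟨C, hC⟩ := hr (n + 2)
    obtain ⟨A, hA⟩ := f.rapidDecay n
    have hC0 : 0 ≤ C := le_trans (by positivity) (hC 0 0)
    have hJ : 0 ≤ ∫ z, decayTwo z := integral_nonneg decayTwo_nonneg
    have hKn : 0 ≤ ∫ z, K z := integral_nonneg fun z => by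
      simpa using (norm_nonneg _).trans (hK z 0)
    set J := ∫ z, decayTwo z
    set m := ∫ z, K z
    have hpos : 0 < C * J + 1 := by positivity
    obtain ⟨ε, hε0, hε⟩ : ∃ ε, 0 < ε ∧ ε = min 1 ((1 - m) / 2 / (C * J + 1)) :=
      ⟨_, lt_min one_pos (div_pos (by linarith) hpos), rfl⟩
    have hε1 : ε ≤ 1 := hε.trans_le (min_le_left _ _)
    have hε2 : ε * (C * J + 1) ≤ (1 - m) / 2 :=
      (le_div_iff₀ hpos).1 (hε.trans_le (min_le_right _ _))
    refine ⟨ε, m + ε * C * J, A, hε0, hε1, by positivity, by nlinarith, fun k => ?_⟩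
    induction k with
    | zero =>
      intro x
      rw [pow_zero, one_mul, hs0]
      refine le_trans ?_ (hA x)
      gcongr
      exact mul_le_of_le_one_left (abs_nonneg _) hε1
    | succ k ih =>
      intro x
      rw [hss, norm_neg, pow_succ', mul_assoc]
      exact weighted_integral_le hKi hK hC hε0.le hε1 ih x
  have sum_geo : ∀ {q : ℝ} (A : ℝ), 0 ≤ q → q < 1 → Summable fun k : ℕ => q ^ k * A :=
    fun A h0 h1 => (summable_geometric_of_lt_one h0 h1).mul_right A
  obtain ⟨_, q, A, _, _, hq0, hq1, hb⟩ := key 0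
  simp only [pow_zero, one_mul] at hb
  have hsum : ∀ x, Summable fun k => s k x := fun x =>
    Summable.of_norm_bounded (sum_geo A hq0 hq1) fun k => hb k x
  have hGc : Continuous fun x => ∑' k, s k x :=
    continuous_tsum (fun k => (s k).continuous) (sum_geo A hq0 hq1) hb
  have hGd : RapidDecay fun x => ∑' k, s k x := by
    intro n
    obtain ⟨ε, q, A, hε, hε1, hq0, hq1, hb⟩ := key n
    refine ⟨(ε⁻¹) ^ n * ∑' k, q ^ k * A, fun x => ?_⟩
    have hw : 0 < (1 + ε * |x|) ^ n := by positivity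
    have h1 : ‖∑' k, s k x‖ ≤ ∑' k, ((1 + ε * |x|) ^ n)⁻¹ * (q ^ k * A) :=
      tsum_of_norm_bounded ((sum_geo A hq0 hq1).mul_left _).hasSum fun k => by
        rw [inv_mul_eq_div, le_div_iff₀' hw]
        exact hb k x
    rw [tsum_mul_left, inv_mul_eq_div, le_div_iff₀' hw] at h1
    have h2 : 1 + |x| ≤ ε⁻¹ * (1 + ε * |x|) := by
      rw [mul_add, inv_mul_cancel_left₀ hε.ne', mul_one]
      gcongr
      exact (one_le_inv₀ hε).2 hε1
    calc (1 + |x|) ^ n * ‖∑' k, s k x‖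
        ≤ (ε⁻¹ * (1 + ε * |x|)) ^ n * ‖∑' k, s k x‖ := by gcongr
      _ = ε⁻¹ ^ n * ((1 + ε * |x|) ^ n * ‖∑' k, s k x‖) := by rw [mul_pow]; ring
      _ ≤ _ := by gcongr
  have heq : ∀ x, (∑' k, s k x) + ∫ y, r x y * ∑' k, s k y = f x := by
    intro x
    have h1 : HasSum (fun k => ∫ y, r x y * s k y) (∫ y, r x y * ∑' k, s k y) := by
      refine hasSum_integral_of_dominated_convergence (fun k y => q ^ k * A * K (x - y))
        (fun k => ((hrc x).mul (s k).continuous).aestronglyMeasurable)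
        (fun k => Filter.Eventually.of_forall fun y => ?_)
        (Filter.Eventually.of_forall fun y => (sum_geo A hq0 hq1).mul_right _) ?_
        (Filter.Eventually.of_forall fun y => (hsum y).hasSum.mul_left _)
      · rw [norm_mul, mul_comm]
        exact mul_le_mul (hb k y) (hK x y) (norm_nonneg _) ((norm_nonneg _).trans (hb k y))
      · simp_rw [tsum_mul_right]
        exact (hKi.comp_sub_left x).const_mul _
    rw [← h1.tsum_eq, (hsum x).tsum_eq_zero_add]
    simp only [hss, tsum_neg, hs0]
    ring
  obtain ⟨p, hp⟩ := hT _ hGd hGc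
  have hg : ∀ x, (f - p) x = ∑' k, s k x := fun x => by
    rw [sub_apply, hp, ← heq x]
    ring
  refine ⟨f - p, fun x => ?_⟩
  simp only [hg]
  exact heq x

section

variable {a : ℝ → ℝ} {R M : ℝ}

theorem osc_comp_div_derivSchwartz (ha : Cutoff a R) {h : ℝ} (hh : 0 < h) (ζ d : ℝ) :
    osc (fun ξ => a (ξ / h)) (ha.comp_div hh).derivSchwartz ζ d =
      osc a ha.derivSchwartz (h * ζ) d := by
  unfold osc
  have hc := Measure.integral_comp_div (fun ξ : ℝ =>
    Complex.exp (Complex.I * ((h * ζ : ℝ) : ℂ) * ξ) *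
    ((Real.exp (d * a ξ) : ℝ) : ℂ) * ha.derivSchwartz ξ) h
  rw [abs_of_pos hh] at hc
  rw [← inv_smul_smul₀ hh.ne' (∫ ξ : ℝ, Complex.exp (Complex.I * ((h * ζ : ℝ) : ℂ) * ξ) *
    ((Real.exp (d * a ξ) : ℝ) : ℂ) * ha.derivSchwartz ξ), ← hc, ← integral_smul]
  congr 1; ext ξ
  have hd : HasDerivAt (fun ξ => a (ξ / h)) (deriv a (ξ / h) * (1 / h)) ξ :=
    ((ha.differentiable (ξ / h)).hasDerivAt).comp ξ ((hasDerivAt_id ξ).div_const h)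
  have hh' : (h : ℂ) ≠ 0 := by exact_mod_cast hh.ne'
  rw [Cutoff.derivSchwartz_apply, Cutoff.derivSchwartz_apply, hd.deriv, Complex.real_smul]
  rw [show Complex.I * ((h * ζ : ℝ) : ℂ) * ((ξ / h : ℝ) : ℂ) = Complex.I * ζ * ξ by
    push_cast; field_simp]
  push_cast
  ring

theorem one_add_pow_mul_norm_oscKernel_comp_div_le (ha : Cutoff a R) (hM : 0 ≤ M) (n : ℕ) :
    ∃ C, 0 ≤ C ∧ ∀ h, ∀ hh : 1 ≤ h, ∀ x y, (1 + h * |x - y|) ^ n *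
      ‖Complex.I * M / (2 * Real.pi) * oscKernel (fun ξ => a (ξ / h)) M arsinhDeriv 0
        (ha.comp_div (one_pos.trans_le hh)).derivSchwartz x y‖ ≤ C := by
  obtain ⟨C, hC0, hC⟩ := osc_arsinh_sub_decay ha hM n ha.derivSchwartz
  refine ⟨M / (2 * Real.pi) * C, by positivity, fun h hh x y => ?_⟩
  have h1 := norm_segAvg_deriv_arsinh_le x y
  have h2 : ‖(Complex.I * M / (2 * Real.pi) : ℂ)‖ = M / (2 * Real.pi) := by
    simp [abs_of_nonneg hM, abs_of_nonneg Real.pi_pos.le]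
  have h3 := hC h hh x y
  rw [oscKernel, osc_comp_div_derivSchwartz ha (one_pos.trans_le hh), norm_mul, norm_mul, h2]
  set N := ‖osc a ha.derivSchwartz (h * (x - y)) (M * (Real.arsinh x - Real.arsinh y))‖
  calc _ ≤ (1 + h * |x - y|) ^ n * (M / (2 * Real.pi) * (1 * N)) := by
        gcongr
    _ = M / (2 * Real.pi) * ((1 + h * |x - y|) ^ n * N) := by ring
    _ ≤ _ := by gcongr

/-- Surjectivity for slowly varying cutoffs. -/
theorem exists_osc_comp_div_eq (ha : Cutoff a R) (hM : 0 ≤ M) :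
    ∃ h₀, ∀ h, h₀ ≤ h → 1 ≤ h → ∀ f : SchwartzMap ℝ ℂ, ∃ v : SchwartzMap ℝ ℂ,
      ∀ x, osc (fun ξ => a (ξ / h)) v x (M * Real.arsinh x) = 2 * Real.pi * f x := by
  obtain ⟨C, hC0, hC⟩ := one_add_pow_mul_norm_oscKernel_comp_div_le ha hM 2
  refine ⟨C * (∫ z, decayTwo z) + 1, fun h hh0 hh f => ?_⟩
  have hpos : 0 < h := one_pos.trans_le hh
  set r : ℝ → ℝ → ℂ := fun x y => Complex.I * M / (2 * Real.pi) *
    oscKernel (fun ξ => a (ξ / h)) M arsinhDeriv 0 (ha.comp_div hpos).derivSchwartz x y with hr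
  have hKi : Integrable fun z => C * decayTwo (h * z) :=
    (integrable_decayTwo.comp_mul_left' hpos.ne').const_mul C
  obtain ⟨g, hg⟩ := exists_schwartzMap_add_integral_eq (r := r) hKi
    (fun x y => by
      rw [decayTwo, ← div_eq_mul_inv, le_div_iff₀' (by positivity), abs_mul, abs_of_pos hpos]
      exact hC h hh x y)
    (by
      rw [integral_const_mul, Measure.integral_comp_mul_left decayTwo, abs_of_pos (inv_pos.2 hpos),
        smul_eq_mul, mul_left_comm, inv_mul_lt_iff₀ hpos]
      linarith)
    (fun n => by
      obtain ⟨C', -, hC'⟩ := one_add_pow_mul_norm_oscKernel_comp_div_le ha hM n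
      refine ⟨C', fun x y => le_trans ?_ (hC' h hh x y)⟩
      refine mul_le_mul_of_nonneg_right (pow_le_pow_left₀ (by positivity) ?_ n) (norm_nonneg _)
      linarith [le_mul_of_one_le_left (abs_nonneg (x - y)) hh])
    (fun x => continuous_const.mul
      (continuous_oscKernel (ha.comp_div hpos) continuous_arsinhDeriv 0 _ x))
    (fun g hg hgc => by
      obtain ⟨p, hp⟩ := exists_schwartzMap_oscKernel (ha.comp_div hpos) hM
        arsinh_hasTemperateGrowth.deriv 0 (ha.comp_div hpos).derivSchwartz hg hgc
      refine ⟨(Complex.I * M / (2 * Real.pi) : ℂ) • p, fun x => ?_⟩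
      rw [smul_apply, hp, smul_eq_mul, ← integral_const_mul]
      simp only [hr, mul_assoc]) f
  obtain ⟨v, hv⟩ := exists_schwartzMap_osc_bwd (ha.comp_div hpos) hM g
  refine ⟨v, fun x => ?_⟩
  rw [osc_comp_osc_eq (ha.comp_div hpos) hM g v hv, ← hg x]
  simp only [hr, mul_assoc]
  rw [integral_const_mul]
  have := Complex.ofReal_ne_zero.2 Real.pi_ne_zero
  field_simp

/-- Injectivity for slowly varying cutoffs. -/
theorem eq_zero_of_osc_comp_div_eq_zero (ha : Cutoff a R) (hM : 0 ≤ M) :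
    ∃ h₀, ∀ h, h₀ ≤ h → 1 ≤ h → ∀ v : SchwartzMap ℝ ℂ,
      (∀ x, osc (fun ξ => a (ξ / h)) v x (M * Real.arsinh x) = 0) → v = 0 := by
  obtain ⟨L, hL0, hL⟩ := ha.exists_lipschitz
  have hJ : 0 ≤ ∫ τ, regMajorant τ := integral_nonneg regMajorant_nonneg
  refine ⟨2 * (M * L) + M * L * ∫ τ, regMajorant τ, fun h hh0 hh v hv => ?_⟩
  have hpos : 0 < h := one_pos.trans_le hh
  have hML : 0 ≤ M * L := mul_nonneg hM hL0
  have h1 : 0 ≤ M * L * ∫ τ, regMajorant τ := mul_nonneg hML hJ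
  refine eq_zero_of_osc_eq_zero (c := M * L / h) (ha.comp_div hpos) hM (by positivity) ?_
    (fun ξ η => ?_) ?_ v hv
  · rw [div_le_iff₀ hpos]
    linarith
  · calc M * |a (ξ / h) - a (η / h)| ≤ M * (L * |ξ / h - η / h|) := by gcongr; exact hL _ _
      _ = M * L / h * |ξ - η| := by
        rw [← sub_div, abs_div, abs_of_pos hpos]; ring
  · have h2 : M * L / h * ∫ τ, regMajorant τ ≤ 1 := by
      rw [div_mul_eq_mul_div, div_le_one hpos]
      linarith
    linarith [Real.pi_gt_three]

theorem OscAdmissible.osc_add {β : ℝ → ℝ} {D : Set ℝ} {K : ℝ → ℝ} {m : ℕ}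
    (H : OscAdmissible β D K m) (u v : SchwartzMap ℝ ℂ) (ζ : ℝ) {d : ℝ} (hd : d ∈ D) :
    osc β (u + v : SchwartzMap ℝ ℂ) ζ d = osc β u ζ d + osc β v ζ d := by
  unfold osc
  rw [← integral_add (H.integrable u ζ hd) (H.integrable v ζ hd)]
  simp only [add_apply, mul_add]

theorem osc_smul (β : ℝ → ℝ) (c : ℂ) (u : SchwartzMap ℝ ℂ) (ζ d : ℝ) :
    osc β (c • u : SchwartzMap ℝ ℂ) ζ d = c * osc β u ζ d := by
  unfold osc
  rw [← integral_const_mul]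
  simp only [smul_apply, smul_eq_mul, mul_left_comm]

theorem hatS_add (u v : SchwartzMap ℝ ℂ) : hatS (u + v) = hatS u + hatS v := by
  ext ξ
  rw [add_apply]
  simp only [hatS_apply, hat_eq_osc]
  exact (oscAdmissible_arsinh 0).osc_add u v _ (by simp)

theorem hatS_smul (c : ℂ) (u : SchwartzMap ℝ ℂ) : hatS (c • u) = c • hatS u := by
  ext ξ
  rw [smul_apply, smul_eq_mul]
  simp only [hatS_apply, hat_eq_osc]
  exact osc_smul _ c u _ _

/-- The oscillatory operator of a cutoff, as a linear map on Schwartz functions. -/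
theorem exists_linearMap_osc (ha : Cutoff a R) (hM : 0 ≤ M) :
    ∃ E : SchwartzMap ℝ ℂ →ₗ[ℂ] SchwartzMap ℝ ℂ, ∀ u x, E u x =
      (((2 * Real.pi)⁻¹ : ℝ) : ℂ) * osc a (hatS u) x (M * Real.arsinh x) := by
  choose p hp using fun v => exists_schwartzMap_osc_fwd ha hM v
  let F : SchwartzMap ℝ ℂ →ₗ[ℂ] SchwartzMap ℝ ℂ :=
    { toFun := fun u => p (hatS u)
      map_add' := fun u v => SchwartzMap.ext fun x => by
        rw [add_apply, hp, hp, hp, hatS_add]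
        exact ha.oscAdmissible.osc_add _ _ _ trivial
      map_smul' := fun c u => SchwartzMap.ext fun x => by
        rw [RingHom.id_apply, smul_apply, hp, hp, hatS_smul]
        exact osc_smul _ _ _ _ _ }
  refine ⟨(((2 * Real.pi)⁻¹ : ℝ) : ℂ) • F, fun u x => ?_⟩
  rw [← hp]
  rfl

end

/-- invertibility on `𝒮(ℝ)` of the operator `e^{λ}(x,D)` associated to
`λ(x,ξ) = M·ω(ξ/h)·∫₀ˣ ⟨y⟩⁻¹ dy` for `h` large enough. -/
theorem stmt17 (M R : ℝ) (hM : 0 < M) (hR : 1 < R)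
    (ω : ℝ → ℝ) (hω : ContDiff ℝ (⊤ : ℕ∞) ω) (hωb : ∀ ξ : ℝ, |ω ξ| ≤ 1)
    (hω0 : ∀ ξ : ℝ, |ξ| ≤ 1 → ω ξ = 0)
    (hωcp : ∀ ξ₁ ξ₂ : ℝ, R ≤ ξ₁ → R ≤ ξ₂ → ω ξ₁ = ω ξ₂)
    (hωcm : ∀ ξ₁ ξ₂ : ℝ, ξ₁ ≤ -R → ξ₂ ≤ -R → ω ξ₁ = ω ξ₂) :
    ∃ h₁ : ℝ, 1 ≤ h₁ ∧ ∀ h : ℝ, h₁ ≤ h →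
      ∃ E : SchwartzMap ℝ ℂ →ₗ[ℂ] SchwartzMap ℝ ℂ,
        (∀ u : SchwartzMap ℝ ℂ, ∀ x : ℝ,
          E u x = psdo1
            (fun x' ξ' =>
              ((Real.exp (M * ω (ξ' / h) * ∫ y in (0:ℝ)..x', (jb y)⁻¹) : ℝ) : ℂ))
            (fun y => u y) x) ∧
        Function.Bijective E := by
  have ha : Cutoff ω R := ⟨hω, hωb, hωcp, hωcm⟩
  obtain ⟨h₀, hsurj⟩ := exists_osc_comp_div_eq ha hM.le
  obtain ⟨h₂, hinj⟩ := eq_zero_of_osc_comp_div_eq_zero ha hM.le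
  refine ⟨max 1 (max h₀ h₂), le_max_left _ _, fun h hh => ?_⟩
  obtain ⟨hh1, hh⟩ := max_le_iff.1 hh
  obtain ⟨hh0, hh2⟩ := max_le_iff.1 hh
  obtain ⟨E, hE⟩ := exists_linearMap_osc (ha.comp_div (one_pos.trans_le hh1)) hM.le
  have hpi : (Real.pi : ℂ) ≠ 0 := Complex.ofReal_ne_zero.2 Real.pi_ne_zero
  refine ⟨E, fun u x => ?_, (injective_iff_map_eq_zero E).2 fun u hu => ?_, fun f => ?_⟩
  · rw [hE, psdo1_eq, coe_hatS]
  · refine hatS_injective (hinj h hh2 hh1 _ fun x => ?_)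
    have h1 := hE u x
    rw [hu] at h1
    simpa [hpi] using h1.symm
  · obtain ⟨v, hv⟩ := hsurj h hh0 hh1 f
    obtain ⟨u, rfl⟩ := exists_hatS_eq v
    refine ⟨u, SchwartzMap.ext fun x => ?_⟩
    rw [hE, hv]
    push_cast
    field_simp
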